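/- Every 3-connected W-state graph is a W-cone. -/

import Mathlib

/-! Multigraphs (parallel edges allowed, no loops) with half-edge 2-colourings,
    matchings, W-state graphs and W-cones, following the paper. -/

structure Multigraph (V E : Type) where
  fst : E → V
  snd : E → V
  no_loop : ∀ e, fst e ≠ snd e

namespace Multigraph

variable {V E : Type} (G : Multigraph V E)

/-- Edge `e` is incident with vertex `v`. -/
def Inc (e : E) (v : V) : Prop := G.fst e = v ∨ G.snd e = v

/-- Adjacency using only edges in the edge set `F`. -/
def AdjIn (F : Set E) (u v : V) : Prop :=
  u ≠ v ∧ ∃ e ∈ F, G.Inc e u ∧ G.Inc e v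

def Adj (u v : V) : Prop := G.AdjIn Set.univ u v

/-- Reachability inside the vertex set `S`, using only edges in `F`. -/
def ReachOn (F : Set E) (S : Set V) (u v : V) : Prop :=
  Relation.ReflTransGen (fun a b => a ∈ S ∧ b ∈ S ∧ G.AdjIn F a b) u v

/-- The subgraph with edge set `F` induced on the vertex set `S` is connected. -/
def ConnectedOn (F : Set E) (S : Set V) : Prop :=
  ∀ u ∈ S, ∀ v ∈ S, G.ReachOn F S u v

def Connected : Prop := G.ConnectedOn Set.univ Set.univ

/-- `K` is a connected component of the subgraph with edge set `F` induced on `S`. -/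
def IsCompOn (F : Set E) (S : Set V) (K : Set V) : Prop :=
  ∃ v ∈ S, K = {u | u ∈ S ∧ G.ReachOn F S u v}

def IsMatching (M : Set E) : Prop :=
  ∀ e ∈ M, ∀ f ∈ M, e ≠ f → ∀ v : V, ¬ (G.Inc e v ∧ G.Inc f v)

/-- `M` is a perfect matching of the subgraph of `G` induced on `S`. -/
def IsPerfectMatchingOn (S : Set V) (M : Set E) : Prop :=
  (∀ e ∈ M, G.fst e ∈ S ∧ G.snd e ∈ S) ∧
  ∀ v ∈ S, ∃! e, e ∈ M ∧ G.Inc e v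

def IsPerfectMatching (M : Set E) : Prop :=
  G.IsPerfectMatchingOn Set.univ M

/-- Every edge lies in some perfect matching. -/
def MatchingCovered : Prop :=
  ∀ e : E, ∃ M : Set E, G.IsPerfectMatching M ∧ e ∈ M

/-- The subgraph with edge set `F` induced on `K` is factor-critical. -/
def FactorCriticalOn (F : Set E) (K : Set V) : Prop :=
  ∀ v ∈ K, ∃ M : Set E, M ⊆ F ∧ G.IsPerfectMatchingOn (K \ {v}) M

def FactorCritical : Prop := G.FactorCriticalOn Set.univ Set.univ

/-- `M` is a maximum matching among matchings using only edges in `F`. -/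
def IsMaxMatchingIn (F M : Set E) : Prop :=
  M ⊆ F ∧ G.IsMatching M ∧
  ∀ N : Set E, N ⊆ F → G.IsMatching N → N.ncard ≤ M.ncard

/-- Half-edge 2-colourings are functions `c : E → V → Bool`
    (`true` = red, `false` = blue; only the values at endpoints matter). -/
def Bichromatic (c : E → V → Bool) (e : E) : Prop :=
  c e (G.fst e) ≠ c e (G.snd e)

/-- The monochromatic edges. -/
def MonoEdges (c : E → V → Bool) : Set E := {e | ¬ G.Bichromatic c e}

/-- Every vertex has an incident red half-edge. -/
def VertexCond (c : E → V → Bool) : Prop :=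
  ∀ v : V, ∃ e : E, G.Inc e v ∧ c e v = true

/-- Every perfect matching contains exactly one bichromatic edge. -/
def MatchingCond (c : E → V → Bool) : Prop :=
  ∀ M : Set E, G.IsPerfectMatching M → ∃! e, e ∈ M ∧ G.Bichromatic c e

/-- All monochromatic edges are blue. -/
def NoRedMono (c : E → V → Bool) : Prop :=
  ∀ e : E, ¬ G.Bichromatic c e → c e (G.fst e) = false

/-- W-state graph. -/
def IsWState (c : E → V → Bool) : Prop :=
  G.MatchingCovered ∧ G.MatchingCond c ∧ G.VertexCond c ∧ G.NoRedMono c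

def Universal (v : V) : Prop := ∀ u : V, u ≠ v → G.Adj u v

/-- W-cone with apex `v`. -/
def IsWConeWithApex (c : E → V → Bool) (v : V) : Prop :=
  G.MatchingCovered ∧ G.Universal v ∧
  (∀ e : E, G.Bichromatic c e ↔ G.Inc e v) ∧
  G.VertexCond c ∧ G.NoRedMono c

def IsWCone (c : E → V → Bool) : Prop := ∃ v : V, G.IsWConeWithApex c v

/-- `e` and `f` are parallel edges (same pair of endpoints). -/
def Parallel (e f : E) : Prop :=
  (G.fst e = G.fst f ∧ G.snd e = G.snd f) ∨
  (G.fst e = G.snd f ∧ G.snd e = G.fst f)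

/-- The cut `δ(X)`. -/
def CutEdges (X : Set V) : Set E :=
  {e | (G.fst e ∈ X ∧ G.snd e ∉ X) ∨ (G.fst e ∉ X ∧ G.snd e ∈ X)}

/-- `δ(X)` is a tight cut. -/
def IsTightCut (X : Set V) : Prop :=
  ∀ M : Set E, G.IsPerfectMatching M → ∃! e, e ∈ M ∧ e ∈ G.CutEdges X

def Bipartite : Prop :=
  ∃ f : V → Bool, ∀ e : E, f (G.fst e) ≠ f (G.snd e)

/-- A brick: non-bipartite matching-covered graph with no non-trivial tight cut. -/
def IsBrick : Prop :=
  G.MatchingCovered ∧ ¬ G.Bipartite ∧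
  ∀ X : Set V, 2 ≤ X.ncard → 2 ≤ (Set.univ \ X).ncard → ¬ G.IsTightCut X

end Multigraph

section Matchable

variable {V : Type*} [DecidableEq V]

/-- `Matchable R S`: the finite set `S` is partitioned into pairs related by `R`. -/
inductive Matchable (R : V → V → Prop) : Finset V → Prop
  | empty : Matchable R ∅
  | pair {a b : V} {S : Finset V} (ha : a ∉ S) (hb : b ∉ S) (hab : a ≠ b) (h : R a b)
      (hS : Matchable R S) : Matchable R (insert a (insert b S))

namespace Matchable

variable {R R' : V → V → Prop} {S T X : Finset V}

theorem mono (h : Matchable R S) (hR : ∀ a ∈ S, ∀ b ∈ S, R a b → R' a b) : Matchable R' S := by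
  induction h with
  | empty => exact .empty
  | pair ha hb hab h _ ih =>
    exact .pair ha hb hab (hR _ (by simp) _ (by simp) h)
      (ih fun a ha b hb => hR a (by simp [ha]) b (by simp [hb]))

theorem add_pair {a b : V} (ha : a ∈ S) (hb : b ∈ S) (hab : a ≠ b) (h : R a b)
    (hS : Matchable R (S \ {a, b})) : Matchable R S := by
  have := Matchable.pair (a := a) (b := b) (by simp) (by simp) hab h hS
  convert this using 1
  grind

theorem union (hS : Matchable R S) (hT : Matchable R T) (hd : Disjoint S T) :
    Matchable R (S ∪ T) := by
  induction hS with
  | empty => simpa using hT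
  | @pair a b S ha hb hab h _ ih =>
    simp only [Finset.disjoint_insert_left] at hd
    have := Matchable.pair (a := a) (b := b) (by grind) (by grind) hab h (ih hd.2.2)
    convert this using 1
    grind

theorem remove (hR : ∀ a b, R a b → R b a) (hS : Matchable R S) :
    ∀ a ∈ S, ∃ b ∈ S, b ≠ a ∧ R a b ∧ Matchable R (S \ {a, b}) := by
  induction hS with
  | empty => simp
  | @pair a b S ha hb hab h hS ih =>
    intro c hc
    by_cases hca : c = a
    · subst hca
      refine ⟨b, by simp, hab.symm, h, ?_⟩
      convert hS using 1
      grind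
    by_cases hcb : c = b
    · subst hcb
      refine ⟨a, by simp, hab, hR _ _ h, ?_⟩
      convert hS using 1
      grind
    have hcS : c ∈ S := by grind
    obtain ⟨d, hd, hdc, hcd, hm⟩ := ih c hcS
    refine ⟨d, by grind, hdc, hcd, ?_⟩
    have := Matchable.pair (a := a) (b := b) (by grind) (by grind) hab h hm
    convert this using 1
    grind

theorem even_card (hS : Matchable R S) : Even S.card := by
  induction hS with
  | empty => simp
  | @pair a b S ha hb hab h hS ih =>
    rw [Finset.card_insert_of_notMem (by grind), Finset.card_insert_of_notMem hb]
    grind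

theorem of_closed (hR : ∀ a b, R a b → R b a) (hS : Matchable R S) :
    ∀ X ⊆ S, (∀ a ∈ X, ∀ b ∈ S \ X, ¬ R a b) → Matchable R X := by
  induction hS with
  | empty =>
    intro X hX _
    rw [Finset.subset_empty.1 hX]
    exact .empty
  | @pair a b S ha hb hab h hS ih =>
    intro X hX hcl
    have hm := ih (X ∩ S) (by grind) (by grind)
    by_cases haX : a ∈ X
    · have hbX : b ∈ X := by
        by_contra hbX
        exact hcl a haX b (by grind) h
      refine add_pair haX hbX hab h ?_
      convert hm using 1
      grind
    · have hbX : b ∉ X := fun hbX => hcl b hbX a (by grind) (hR _ _ h)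
      convert hm using 1
      grind

theorem of_pendant (hR : ∀ a b, R a b → R b a) (hS : Matchable R S) {x : V} (hX : X ⊆ S)
    (hx : x ∈ S \ X) (he : Even X.card) (hcl : ∀ a ∈ X, ∀ b ∈ S \ X, R a b → b = x) :
    Matchable R (S \ X) := by
  obtain ⟨y, hy, hyx, hxy, hm⟩ := hS.remove hR x (by grind)
  by_cases hyX : y ∈ X
  · have := (hm.of_closed hR (X \ {y}) (by grind) (by grind)).even_card
    rw [Finset.card_sdiff_of_subset (by simpa using hyX)] at this
    have hpos : 0 < X.card := Finset.card_pos.2 ⟨y, hyX⟩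
    simp at this
    grind
  · refine add_pair hx (by grind) hyx.symm hxy ?_
    refine hm.of_closed hR _ (by grind) ?_
    intro a ha b hb hab
    have := hcl b (by grind) a (by grind) (hR _ _ hab)
    grind

/-- An alternating path from `x` out of `X`. -/
theorem exchange_into (hR : ∀ a b, R a b → R b a) {U : Finset V} :
    ∀ (n : ℕ) (X : Finset V), X.card = n → Disjoint X U → Matchable R X → ∀ x ∈ X,
      Matchable R ((X ∪ U) \ {x}) → ∃ u ∈ U, Matchable R (insert u (X \ {x})) := by
  intro n
  induction n using Nat.strong_induction_on with
  | _ n ih =>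
    intro X hn hd hX x hx hN
    have hd' := Finset.disjoint_left.1 hd
    obtain ⟨x1, hx1, hne, hxx1, hm⟩ := hX.remove hR x hx
    obtain ⟨x2, hx2, hne2, hx12, hm2⟩ := hN.remove hR x1 (by (clear ih; grind))
    by_cases h2 : x2 ∈ U
    · refine ⟨x2, h2, add_pair (a := x1) (b := x2) (by (clear ih; grind))
      (by (clear ih; grind)) hne2.symm hx12 ?_⟩
      convert hm using 1
      (clear ih; grind)
    · have hlt : (X \ {x, x1}).card < n := by
        rw [← hn]
        exact Finset.card_lt_card (by (clear ih; grind))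
      obtain ⟨u, hu, hum⟩ := ih _ hlt (X \ {x, x1}) rfl
        (Finset.disjoint_left.2 (by (clear ih; grind))) hm x2 (by (clear ih; grind))
        (by convert hm2 using 1; (clear ih; grind))
      refine ⟨u, hu, add_pair (a := x1) (b := x2) (by (clear ih; grind))
        (by (clear ih; grind)) hne2.symm hx12 ?_⟩
      convert hum using 1
      (clear ih; grind)

/-- An alternating path from `x` to `a`, listed from `x`. -/
theorem exists_path (hR : ∀ a b, R a b → R b a) {a : V} :
    ∀ (n : ℕ) (X : Finset V), X.card = n → a ∉ X → Matchable R X → ∀ x ∈ X,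
      Matchable R (insert a (X \ {x})) →
      ∃ l : List V, (∀ y ∈ x :: l, y ∈ X) ∧ (x :: l).Nodup ∧ (x :: l).IsChain R ∧
        Even (x :: l).length ∧ R ((x :: l).getLast (by simp)) a ∧
        Matchable R (X \ (x :: l).toFinset) := by
  intro n
  induction n using Nat.strong_induction_on with
  | _ n ih =>
    intro X hn ha hX x hx hN
    obtain ⟨x1, hx1, hne, hxx1, hm⟩ := hX.remove hR x hx
    obtain ⟨x2, hx2, hne2, hx12, hm2⟩ := hN.remove hR x1 (by (clear ih; grind))
    by_cases h2 : x2 = a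
    · subst h2
      refine ⟨[x1], by (clear ih; grind), by simp [hne.symm], by simp [hxx1], by simp, by simpa
        using hx12, ?_⟩
      convert hm using 1
      ext; simp
    · have hlt : (X \ {x, x1}).card < n := by
        rw [← hn]
        exact Finset.card_lt_card (by (clear ih; grind))
      obtain ⟨l, h1, hnd, hch, hev, hl, hml⟩ := ih _ hlt (X \ {x, x1}) rfl
        (by (clear ih; grind)) hm x2 (by (clear ih; grind))
        (by convert hm2 using 1; (clear ih; grind))
      refine ⟨x1 :: x2 :: l, by (clear ih; grind), ?_, ?_, ?_, ?_, ?_⟩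
      · rw [List.nodup_cons, List.nodup_cons]
        exact ⟨by (clear ih; grind), by (clear ih; grind), hnd⟩
      · simp only [List.isChain_cons_cons] at hch ⊢
        exact ⟨hxx1, hx12, hch⟩
      · simp only [List.length_cons] at hev ⊢
        (clear ih; grind)
      · simpa using hl
      · convert hml using 1
        ext; simp; (clear ih; grind)

/-- Gallai's exchange: a set missed in two different pairs. -/
theorem exchange_pairs (hR : ∀ a b, R a b → R b a) {u w v' : V} :
    ∀ (n : ℕ) (X : Finset V), X.card = n → u ∈ X → w ∈ X → v' ∈ X → u ≠ w → v' ≠ u → v' ≠ w →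
      ∀ v ∈ X, v ≠ u → v ≠ w → v ≠ v' →
      Matchable R (X \ {u, w}) → Matchable R (X \ {v, v'}) →
      Matchable R X ∨ Matchable R (X \ {v, w}) ∨ Matchable R (X \ {v, u}) := by
  intro n
  induction n using Nat.strong_induction_on with
  | _ n ih =>
    intro X hn hu hw hv' huw hvu' hvw' v hv hvu hvw hvv hN hM
    obtain ⟨v1, hv1, hne, hvv1, hN'⟩ := hN.remove hR v (by (clear ih; grind))
    by_cases h1 : v1 = v'
    · subst h1
      exact .inl (add_pair hv hv' hvv hvv1 hM)
    obtain ⟨v2, hv2, hne2, hv12, hM'⟩ := hM.remove hR v1 (by (clear ih; grind))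
    by_cases h2 : v2 = u
    · subst h2
      right; left
      refine add_pair (a := v1) (b := v2) (by (clear ih; grind))
        (by (clear ih; grind)) hne2.symm hv12 ?_
      convert hN' using 1
      (clear ih; grind)
    by_cases h3 : v2 = w
    · subst h3
      right; right
      refine add_pair (a := v1) (b := v2) (by (clear ih; grind))
        (by (clear ih; grind)) hne2.symm hv12 ?_
      convert hN' using 1
      (clear ih; grind)
    have hlt : (X \ {v, v1}).card < n := by
      rw [← hn]
      exact Finset.card_lt_card (by (clear ih; grind))
    rcases ih _ hlt (X \ {v, v1}) rfl (by (clear ih; grind)) (by (clear ih; grind))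
      (by (clear ih; grind)) huw hvu' hvw' v2 (by (clear ih; grind))
      h2 h3 (by (clear ih; grind)) (by convert hN' using 1; (clear ih; grind))
        (by convert hM' using 1; (clear ih; grind)) with h | h | h
    · exact .inl (add_pair hv (by (clear ih; grind)) hne.symm hvv1 h)
    · right; left
      refine add_pair (a := v1) (b := v2) (by (clear ih; grind))
        (by (clear ih; grind)) hne2.symm hv12 ?_
      convert h using 1
      (clear ih; grind)
    · right; right
      refine add_pair (a := v1) (b := v2) (by (clear ih; grind))
        (by (clear ih; grind)) hne2.symm hv12 ?_
      convert h using 1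
      (clear ih; grind)

end Matchable

end Matchable

section TightPair

variable {V : Type*} [DecidableEq V]

/-- Two disjoint factor-critical pieces `A`, `B` in a graph where every vertex lies on an edge
between `A` and `B`, and no perfect matching of `A ∪ B` uses two such edges. -/
structure TightPair (R : V → V → Prop) (A B : Finset V) : Prop where
  symm : ∀ a b, R a b → R b a
  disj : Disjoint A B
  critA : ∀ a ∈ A, Matchable R (A \ {a})
  critB : ∀ b ∈ B, Matchable R (B \ {b})
  cutA : ∀ a ∈ A, ∃ b ∈ B, R a b
  cutB : ∀ b ∈ B, ∃ a ∈ A, R b a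
  tight : ∀ a ∈ A, ∀ a' ∈ A, ∀ b ∈ B, ∀ b' ∈ B, a ≠ a' → b ≠ b' → R a b → R a' b' →
    ¬ Matchable R ((A ∪ B) \ {a, b, a', b'})

/-- A subset of `A` whose contraction keeps `A` factor-critical. -/
structure Nice (R : V → V → Prop) (A U : Finset V) : Prop where
  sub : U ⊆ A
  crit : ∀ u ∈ U, Matchable R (U \ {u})
  rest : Matchable R (A \ U)
  cross : ∀ a ∈ A \ U, ∃ u ∈ U, Matchable R (insert u ((A \ U) \ {a}))

theorem Nice.of_rest {R : V → V → Prop} {A U : Finset V} (hR : ∀ a b, R a b → R b a)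
    (hA : ∀ a ∈ A, Matchable R (A \ {a})) (sub : U ⊆ A)
    (crit : ∀ u ∈ U, Matchable R (U \ {u})) (rest : Matchable R (A \ U)) : Nice R A U where
  sub := sub
  crit := crit
  rest := rest
  cross a ha := by
    refine Matchable.exchange_into hR _ _ rfl Finset.sdiff_disjoint rest a ha ?_
    rw [Finset.sdiff_union_of_subset sub]
    exact hA a (Finset.mem_sdiff.1 ha).1

theorem Nice.singleton {R : V → V → Prop} {A : Finset V} (hR : ∀ a b, R a b → R b a)
    (hA : ∀ a ∈ A, Matchable R (A \ {a})) {x : V} (hx : x ∈ A) : Nice R A {x} :=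
  .of_rest hR hA (by simpa using hx) (by simpa using Matchable.empty) (hA x hx)

/-- Adjacency after `p` additionally receives all neighbours of `U`. -/
def contractRel (R : V → V → Prop) (U : Finset V) (p a b : V) : Prop :=
  R a b ∨ (a = p ∧ ∃ u ∈ U, R u b) ∨ (b = p ∧ ∃ u ∈ U, R a u)

section contractRel

variable {R : V → V → Prop} {U S : Finset V} {p : V}

omit [DecidableEq V] in
theorem contractRel_symm (hR : ∀ a b, R a b → R b a) (a b : V) (h : contractRel R U p a b) :
    contractRel R U p b a := by
  rcases h with h | ⟨h, u, hu, h'⟩ | ⟨h, u, hu, h'⟩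
  · exact .inl (hR _ _ h)
  · exact .inr (.inr ⟨h, u, hu, hR _ _ h'⟩)
  · exact .inr (.inl ⟨h, u, hu, hR _ _ h'⟩)

theorem Matchable.contractRel (h : Matchable R S) : Matchable (contractRel R U p) S :=
  h.mono fun _ _ _ _ h => .inl h

omit [DecidableEq V] in
theorem contractRel_of_ne {a b : V} (h : contractRel R U p a b) (ha : a ≠ p) (hb : b ≠ p) :
    R a b := by
  rcases h with h | ⟨h, -⟩ | ⟨h, -⟩
  · exact h
  · exact absurd h ha
  · exact absurd h hb

omit [DecidableEq V] in
theorem contractRel_left {b : V} (h : contractRel R U p p b) (hb : b ≠ p) :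
    R p b ∨ ∃ u ∈ U, R u b := by
  rcases h with h | ⟨-, h⟩ | ⟨h, -⟩
  · exact .inl h
  · exact .inr h
  · exact absurd h hb

theorem Matchable.of_contractRel (h : Matchable (_root_.contractRel R U p) S) (hp : p ∉ S) :
    Matchable R S :=
  h.mono fun _ ha _ hb h =>
    contractRel_of_ne h (ne_of_mem_of_not_mem ha hp) (ne_of_mem_of_not_mem hb hp)

theorem Matchable.of_contractRel_mem (hR : ∀ a b, R a b → R b a)
    (h : Matchable (_root_.contractRel R U p) S) (hp : p ∈ S) :
    ∃ b ∈ S, b ≠ p ∧ (R p b ∨ ∃ u ∈ U, R u b) ∧ Matchable R (S \ {p, b}) := by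
  obtain ⟨b, hb, hne, h1, h2⟩ := h.remove (contractRel_symm hR) p hp
  exact ⟨b, hb, hne, contractRel_left h1 hne, h2.of_contractRel (by simp)⟩

end contractRel

namespace TightPair

variable {R : V → V → Prop} {A B U : Finset V}

theorem swap (h : TightPair R A B) : TightPair R B A where
  symm := h.symm
  disj := h.disj.symm
  critA := h.critB
  critB := h.critA
  cutA := h.cutB
  cutB := h.cutA
  tight b hb b' hb' a ha a' ha' hbb haa h1 h2 hm := by
    refine h.tight a ha a' ha' b hb b' hb' haa hbb (h.symm _ _ h1) (h.symm _ _ h2) ?_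
    rw [Finset.union_comm, Finset.insert_comm a b, Finset.pair_comm a' b']
    exact hm

theorem nonadj (h : TightPair R A B) {S : Finset V} {a a' b b' : V} (ha : a ∈ A) (ha' : a' ∈ A)
    (hb : b ∈ B) (hb' : b' ∈ B) (haa : a ≠ a') (hbb : b ≠ b') (h1 : R a b) (h2 : R a' b')
    (hS : S = (A ∪ B) \ {a, b, a', b'}) (hm : Matchable R S) : False :=
  h.tight a ha a' ha' b hb b' hb' haa hbb h1 h2 (hS ▸ hm)

theorem odd_card_of_crit {A : Finset V} (hA : ∀ a ∈ A, Matchable R (A \ {a}))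
    (hne : A.Nonempty) : Odd A.card := by
  obtain ⟨a, ha⟩ := hne
  have := (hA a ha).even_card
  rw [Finset.card_sdiff_of_subset (by simpa using ha)] at this
  have hpos : 0 < A.card := Finset.card_pos.2 ⟨a, ha⟩
  simp at this
  grind

/-- Contracting a nice set to one of its vertices. -/
theorem contract_nice (h : TightPair R A B) (hU : Nice R A U) {u₀ : V} (hu₀ : u₀ ∈ U) :
    TightPair (contractRel R U u₀) (insert u₀ (A \ U)) B := by
  have hsub := hU.sub
  have hu₀A := hsub hu₀
  have hAB := Finset.disjoint_left.1 h.disj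
  have key : ∀ a ∈ A \ U, ∀ b ∈ B, ∀ b' ∈ B, b ≠ b' → contractRel R U u₀ u₀ b →
      contractRel R U u₀ a b' →
      ¬ Matchable R ((insert u₀ (A \ U) ∪ B) \ {u₀, b, a, b'}) := by
    intro a ha b hb b' hb' hbb h1 h2 hm
    have hab' : R a b' := contractRel_of_ne h2 (by rintro rfl; grind) (by rintro rfl; grind)
    obtain ⟨u, hu, hub⟩ : ∃ u ∈ U, R u b := by
      rcases contractRel_left h1 (by rintro rfl; grind) with h | h
      · exact ⟨u₀, hu₀, h⟩
      · exact h
    refine h.nonadj (hsub hu) (Finset.mem_sdiff.1 ha).1 hb hb' (by rintro rfl; grind) hbb hub hab'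
      ?_ (hm.union (hU.crit u hu) ?_)
    · clear hm h2 h1 hab' hub h hU
      grind
    · clear hm h2 h1 hab' hub h hU
      rw [Finset.disjoint_left]; grind
  refine ⟨contractRel_symm h.symm, ?_, ?_, fun b hb => (h.critB b hb).contractRel, ?_, ?_, ?_⟩
  · rw [Finset.disjoint_left]; clear h hU; grind
  · intro a ha
    by_cases hau : a = u₀
    · subst hau
      have := hU.rest
      convert this.contractRel using 1
      clear h hU this; grind
    · have haA : a ∈ A \ U := by clear h hU; grind
      obtain ⟨u, hu, hm⟩ := hU.cross a haA
      obtain ⟨b, hb, hne, hub, hm⟩ := hm.remove h.symm u (by simp)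
      refine Matchable.add_pair (a := u₀) (b := b) ?_ ?_ ?_ (.inr (.inl ⟨rfl, u, hu, hub⟩)) ?_
      · clear h hU hm; grind
      · clear h hU hm; grind
      · clear h hU hm; grind
      · convert hm.contractRel using 1
        clear h hU hm; grind
  · intro a ha
    obtain ⟨b, hb, hab⟩ := h.cutA a (by clear h hU; grind)
    exact ⟨b, hb, .inl hab⟩
  · intro b hb
    obtain ⟨a, ha, hba⟩ := h.cutB b hb
    by_cases haU : a ∈ U
    · exact ⟨u₀, by simp, .inr (.inr ⟨rfl, a, haU, hba⟩)⟩
    · exact ⟨a, by simp [ha, haU], .inl hba⟩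
  · intro a ha a' ha' b hb b' hb' haa hbb h1 h2 hm
    by_cases hau : a = u₀
    · subst hau
      exact key a' (by clear key h hU; grind) b hb b' hb' hbb h1 h2 (hm.of_contractRel (by simp))
    by_cases hau' : a' = u₀
    · subst hau'
      refine key a (by clear key h hU; grind) b' hb' b hb hbb.symm h2 h1 ?_
      convert hm.of_contractRel (by simp) using 1
      clear key h hU; grind
    obtain ⟨p, hp, hpu, hup, hm'⟩ := hm.of_contractRel_mem h.symm (by clear key h hU; grind)
    replace hup : ∃ u ∈ U, R u p := by
      rcases hup with h | h
      · exact ⟨u₀, hu₀, h⟩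
      · exact h
    obtain ⟨u, hu, hup⟩ := hup
    have haA : a ∈ A \ U := by clear key h hU; grind
    have haA' : a' ∈ A \ U := by clear key h hU; grind
    rw [Finset.mem_sdiff] at haA haA'
    have hm2 := hm'.union (hU.crit u hu) (by
      clear key h hU; rw [Finset.disjoint_left]; grind)
    refine h.nonadj haA.1 haA'.1 hb hb' haa hbb
      (contractRel_of_ne h1 hau (by clear key h hU; grind))
      (contractRel_of_ne h2 hau' (by clear key h hU; grind)) rfl
      (Matchable.add_pair (a := u) (b := p) ?_ ?_ ?_ hup (S := (A ∪ B) \ {a, b, a', b'}) ?_)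
    · clear key h hU hm hm' hm2; grind
    · clear key h hU hm hm' hm2; grind
    · clear key h hU hm hm' hm2; grind
    · have hpU : p ∉ U := by clear key h hU hm hm' hm2; grind
      have hbU : b ∉ U := fun hx => hAB (hsub hx) hb
      have hbU' : b' ∉ U := fun hx => hAB (hsub hx) hb'
      convert hm2 using 1
      clear key h hU hm hm' hm2
      ext z
      by_cases hz : z ∈ U
      · have hzA := hsub hz
        have hzB := hAB hzA
        have h1 : z ≠ a := by rintro rfl; exact haA.2 hz
        have h2 : z ≠ a' := by rintro rfl; exact haA'.2 hz
        have h3 : z ≠ b := by rintro rfl; exact hbU hz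
        have h4 : z ≠ b' := by rintro rfl; exact hbU' hz
        have h5 : z ≠ p := by rintro rfl; exact hpU hz
        simp [hz, hzA, hzB, h1, h2, h3, h4, h5]
      · have : z ≠ u := by rintro rfl; exact hz hu
        have : z ≠ u₀ := by rintro rfl; exact hz hu₀
        grind

end TightPair

end TightPair

namespace TightPair

variable {V : Type*} [DecidableEq V] {R : V → V → Prop} {A B U J : Finset V} {v : V}

/-- `J` is attached to the rest of `A ∪ B` through `U ⊆ A` and `v ∈ B` only. -/
structure Attached (R : V → V → Prop) (A B U J : Finset V) (v : V) : Prop where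
  pair : TightPair R A B
  nice : Nice R A U
  mem : v ∈ B
  sub : ∀ j ∈ J, j ∈ A ∨ j ∈ B
  notMem : v ∉ J
  disj : ∀ j ∈ J, j ∉ U
  adj : ∀ j ∈ J, ∀ i, i ∈ A ∨ i ∈ B → R j i → i ∈ J ∨ i ∈ U ∨ i = v

namespace Attached

theorem matchable_left (h : Attached R A B U J v) : Matchable R (J ∩ A) := by
  have hAB := Finset.disjoint_left.1 h.pair.disj
  refine h.nice.rest.of_closed h.pair.symm _ ?_ ?_
  · intro a ha
    have := h.disj a
    simp only [Finset.mem_inter] at ha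
    simp [ha, this]
  · intro a ha b hb hab
    simp only [Finset.mem_inter, Finset.mem_sdiff] at ha hb
    rcases h.adj a ha.1 b (.inl hb.1.1) hab with h1 | h1 | h1
    · exact hb.2 ⟨h1, hb.1.1⟩
    · exact hb.1.2 h1
    · exact hAB hb.1.1 (h1 ▸ h.mem)

theorem matchable_right (h : Attached R A B U J v) : Matchable R (J ∩ B) := by
  have hAB := Finset.disjoint_left.1 h.pair.disj
  refine (h.pair.critB v h.mem).of_closed h.pair.symm _ ?_ ?_
  · intro a ha
    simp only [Finset.mem_inter] at ha
    simp only [Finset.mem_sdiff, Finset.mem_singleton, ha, true_and]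
    rintro rfl
    exact h.notMem ha.1
  · intro a ha b hb hab
    simp only [Finset.mem_inter, Finset.mem_sdiff, Finset.mem_singleton] at ha hb
    rcases h.adj a ha.1 b (.inr hb.1.1) hab with h1 | h1 | h1
    · exact hb.2 ⟨h1, hb.1.1⟩
    · exact hAB (h.nice.sub h1) hb.1.1
    · exact hb.1.2 h1

theorem crit_right (h : Attached R A B U J v) {b : V} (hb : b ∈ insert v (J ∩ B)) :
    Matchable R (insert v (J ∩ B) \ {b}) := by
  have hAB := Finset.disjoint_left.1 h.pair.disj
  have hvJ := h.notMem
  have hvB := h.mem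
  by_cases hbv : b = v
  · subst hbv
    convert h.matchable_right using 1
    clear h
    grind
  have hbJ : b ∈ J ∧ b ∈ B := by simpa [hbv] using hb
  have hX : (B \ J) \ {v} ⊆ B \ {b} := by clear h; grind
  have hcB := (h.pair.critB b hbJ.2).even_card
  have hcJ := h.matchable_right.even_card
  have := (h.pair.critB b hbJ.2).of_pendant h.pair.symm (x := v) hX (by clear h; grind) ?_ ?_
  · convert this using 1
    clear h hcB hcJ this
    ext z
    by_cases hz : z = v
    · subst hz; simp [Ne.symm hbv, hvB]
    · by_cases hzB : z ∈ B <;> by_cases hzJ : z ∈ J <;> simp [hz, hzB, hzJ]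
  · have h1 : (B \ {b}).card = (((B \ J) \ {v}) ∪ (insert v (J ∩ B) \ {b})).card := by
      congr 1
      clear h hcB hcJ
      ext z
      by_cases hz : z = v
      · subst hz; simp [Ne.symm hbv, hvB]
      · by_cases hzB : z ∈ B <;> by_cases hzJ : z ∈ J <;> simp [hz, hzB, hzJ]
        rintro rfl
        exact hzJ hbJ.1
    rw [Finset.card_union_of_disjoint (by
        clear h hcB hcJ h1
        rw [Finset.disjoint_left]; grind),
      Finset.card_sdiff_of_subset (s := {b}) (t := insert v (J ∩ B)) (by simpa using hb),
      Finset.card_insert_of_notMem (by simp [hvJ])] at h1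
    simp only [Finset.card_singleton, Nat.add_sub_cancel] at h1
    rw [h1] at hcB
    exact (Nat.even_add.1 hcB).2 hcJ
  · intro a ha c hc hac
    simp only [Finset.mem_sdiff, Finset.mem_singleton, not_and, not_not] at ha hc
    by_contra hcv
    have hcJ : c ∈ J := by
      by_contra hcJ
      exact hcv (hc.2 ⟨hc.1.1, hcJ⟩)
    rcases h.adj c hcJ a (.inr ha.1.1) (h.pair.symm _ _ hac) with h1 | h1 | h1
    · exact ha.1.2 h1
    · exact hAB (h.nice.sub h1) ha.1.1
    · exact ha.2 h1

theorem crit_contract_left (h : Attached R A B U J v) {a : V} (ha : a ∈ A \ J) :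
    Matchable R ((A \ J) \ {a}) := by
  have hAB := Finset.disjoint_left.1 h.pair.disj
  have hUA := h.nice.sub
  have hdj := h.disj
  rw [Finset.mem_sdiff] at ha
  by_cases haU : a ∈ U
  · have h1 : Matchable R ((A \ U) \ J) := by
      refine h.nice.rest.of_closed h.pair.symm _ Finset.sdiff_subset ?_
      intro b hb c hc hbc
      simp only [Finset.mem_sdiff, not_and, not_not] at hb hc
      rcases h.adj c (hc.2 hc.1) b (.inl hb.1.1) (h.pair.symm _ _ hbc) with h1 | h1 | h1
      · exact hb.2 h1
      · exact hb.1.2 h1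
      · exact hAB hb.1.1 (h1 ▸ h.mem)
    convert h1.union (h.nice.crit a haU) ?_ using 1
    · clear h h1
      grind
    · clear h h1
      rw [Finset.disjoint_left]; grind
  · obtain ⟨u, hu, hm⟩ := h.nice.cross a (by simp [ha, haU])
    have h1 := hm.of_pendant h.pair.symm (x := u) (X := J ∩ A) ?_ ?_ h.matchable_left.even_card ?_
    · convert h1.union (h.nice.crit u hu) ?_ using 1
      · clear h h1 hm
        grind
      · clear h h1 hm
        rw [Finset.disjoint_left]; grind
    · clear h hm; grind
    · clear h hm; grind
    · intro b hb c hc hbc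
      simp only [Finset.mem_sdiff, Finset.mem_inter, Finset.mem_insert, Finset.mem_singleton]
        at hb hc
      rcases hc.1 with hc1 | hc1
      · exact hc1
      rcases h.adj b hb.1 c (.inl hc1.1.1) hbc with h1 | h1 | h1
      · exact absurd ⟨h1, hc1.1.1⟩ hc.2
      · exact absurd h1 hc1.1.2
      · exact absurd (h1 ▸ h.mem) (hAB hc1.1.1)

theorem crit_contract_right (h : Attached R A B U J v) {b : V} (hb : b ∈ B \ J) :
    Matchable R ((B \ J) \ {b}) := by
  have hAB := Finset.disjoint_left.1 h.pair.disj
  have hUA := h.nice.sub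
  have hvJ := h.notMem
  have hvB := h.mem
  rw [Finset.mem_sdiff] at hb
  by_cases hbv : b = v
  · subst hbv
    refine (h.pair.critB b h.mem).of_closed h.pair.symm _ (by clear h; grind) ?_
    intro a ha c hc hac
    simp only [Finset.mem_sdiff, Finset.mem_singleton, not_and, not_not] at ha hc
    have hcJ : c ∈ J := by
      by_contra hcJ
      exact hc.1.2 (hc.2 ⟨hc.1.1, hcJ⟩)
    rcases h.adj c hcJ a (.inr ha.1.1) (h.pair.symm _ _ hac) with h1 | h1 | h1
    · exact ha.1.2 h1
    · exact hAB (hUA h1) ha.1.1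
    · exact ha.2 h1
  · have h1 := (h.pair.critB b hb.1).of_pendant h.pair.symm (x := v) (X := J ∩ B) ?_ ?_
      h.matchable_right.even_card ?_
    · convert h1 using 1
      clear h h1; grind
    · clear h; grind
    · clear h; grind
    · intro a ha c hc hac
      simp only [Finset.mem_sdiff, Finset.mem_inter, Finset.mem_singleton] at ha hc
      rcases h.adj a ha.1 c (.inr hc.1.1) hac with h1 | h1 | h1
      · exact absurd ⟨h1, hc.1.1⟩ hc.2
      · exact absurd hc.1.1 (hAB (hUA h1))
      · exact h1

theorem lift_cut (h : Attached R A B U J v) {a : V} (ha : a ∈ A \ J)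
    (hav : R a v ∨ ∃ j ∈ J, R a j) :
    ∃ a' ∈ insert a (J ∩ A), ∃ b ∈ insert v (J ∩ B), R a' b ∧
      Matchable R (insert a (insert v J) \ {a', b}) := by
  have hAB := Finset.disjoint_left.1 h.pair.disj
  have hUA := h.nice.sub
  have hvJ := h.notMem
  have hvB := h.mem
  have hJ := h.sub
  rw [Finset.mem_sdiff] at ha
  have hvA : v ∉ A := fun hx => hAB hx hvB
  have hJAB : ∀ j ∈ J, j ∈ B → j ∉ A := fun j _ hj hx => hAB hx hj
  have hav' : a ≠ v := by rintro rfl; exact hvA ha.1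
  have main : ∀ b ∈ insert v (J ∩ B), R a b → ∃ a' ∈ insert a (J ∩ A), ∃ b ∈ insert v (J ∩ B),
      R a' b ∧ Matchable R (insert a (insert v J) \ {a', b}) := by
    intro b hb hab
    refine ⟨a, by simp, b, hb, hab, ?_⟩
    convert h.matchable_left.union (h.crit_right hb) ?_ using 1
    · clear h hab hav
      grind
    · clear h hab hav
      rw [Finset.disjoint_left]; grind
  rcases hav with hav | ⟨j, hj, haj⟩
  · exact main v (by simp) hav
  rcases hJ j hj with hjA | hjB
  · obtain ⟨q, hq, hqj, hjq, hm⟩ := h.matchable_left.remove h.pair.symm j (by simp [hj, hjA])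
    rw [Finset.mem_inter] at hq
    obtain ⟨b, hbB, hqb⟩ := h.pair.cutA q hq.2
    have hb : b ∈ insert v (J ∩ B) := by
      rcases h.adj q hq.1 b (.inr hbB) hqb with h1 | h1 | h1
      · simp [h1, hbB]
      · exact absurd hbB (hAB (hUA h1))
      · simp [h1]
    refine ⟨q, by simp [hq], b, hb, hqb, Matchable.add_pair (a := a) (b := j) ?_ ?_ ?_ haj ?_⟩
    · clear h hm hjq haj hqb; grind
    · clear h hm hjq haj hqb; grind
    · rintro rfl; exact ha.2 hj
    · convert hm.union (h.crit_right hb) ?_ using 1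
      · clear h hm hjq haj hqb; grind
      · clear h hm hjq haj hqb; rw [Finset.disjoint_left]; grind
  · exact main j (by simp [hj, hjB]) haj

theorem lift_edge (h : Attached R A B U J v) {p : V} (hp : p ∈ A ∨ p ∈ B) (hpJ : p ∉ J)
    (hpv : p ≠ v) (hr : R v p ∨ ∃ j ∈ J, R j p) :
    Matchable R (insert p (insert v J)) := by
  have hAB := Finset.disjoint_left.1 h.pair.disj
  have hUA := h.nice.sub
  have hvJ := h.notMem
  have hvB := h.mem
  have hJ := h.sub
  by_cases hpA : p ∈ A
  · obtain ⟨a, ha, b, hb, hab, hm⟩ := h.lift_cut (a := p) (by simp [hpA, hpJ])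
      (hr.imp (h.pair.symm _ _) fun ⟨j, hj, hjp⟩ => ⟨j, hj, h.pair.symm _ _ hjp⟩)
    refine Matchable.add_pair (a := a) (b := b) ?_ ?_ ?_ hab hm
    · clear h hm; grind
    · clear h hm; grind
    · clear h hm; grind
  · have hpB : p ∈ B := hp.resolve_left hpA
    have hvp : R v p := by
      rcases hr with hr | ⟨j, hj, hjp⟩
      · exact hr
      rcases h.adj j hj p hp hjp with h1 | h1 | h1
      · exact absurd h1 hpJ
      · exact absurd (hUA h1) hpA
      · exact absurd h1 hpv
    refine Matchable.add_pair (a := v) (b := p) (by simp) (by simp) hpv.symm hvp ?_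
    convert h.matchable_left.union h.matchable_right ?_ using 1
    · clear h hr hvp; grind
    · clear h hr hvp; rw [Finset.disjoint_left]; grind

theorem exists_adj (h : Attached R A B U J v) {a : V} (ha : a ∈ J ∩ A) :
    ∃ j ∈ J, ∃ u ∈ A \ J, R j u := by
  by_contra! hno
  have h1 := h.matchable_left.even_card
  rw [Finset.mem_inter] at ha
  have h2 := ((h.pair.critA a ha.2).of_closed h.pair.symm ((J ∩ A) \ {a}) (by clear h hno; grind)
    (by
      intro b hb c hc
      exact hno b (by clear h hno; grind) c (by clear h hno; grind))).even_card
  rw [Finset.card_sdiff_of_subset (by simp [ha])] at h2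
  have hpos : 0 < (J ∩ A).card := Finset.card_pos.2 ⟨a, by simp [ha]⟩
  simp only [Finset.card_singleton] at h2
  clear h hno
  grind

/-- Contracting `J` onto `v`. -/
theorem contract (h : Attached R A B U J v) :
    TightPair (contractRel R J v) (A \ J) (B \ J) := by
  have hAB := Finset.disjoint_left.1 h.pair.disj
  have hUA := h.nice.sub
  have hvJ := h.notMem
  have hvB := h.mem
  have hJ := h.sub
  have hvA : v ∉ A := fun hx => hAB hx hvB
  have real : ∀ a ∈ A \ J, ∀ b ∈ B \ J, b ≠ v → contractRel R J v a b → R a b := by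
    intro a ha b hb hbv hab
    exact contractRel_of_ne hab (by rintro rfl; simp [hvA] at ha) hbv
  have key : ∀ a ∈ A \ J, ∀ a' ∈ A \ J, ∀ b' ∈ B \ J, a ≠ a' → v ≠ b' → contractRel R J v a v →
      contractRel R J v a' b' →
      ¬ Matchable R ((A \ J ∪ B \ J) \ {a, v, a', b'}) := by
    intro a ha a' ha' b' hb' haa hbv h1 h2 hm
    have hr := real a' ha' b' hb' hbv.symm h2
    obtain ⟨c, hc, d, hd, hcd, hm'⟩ := h.lift_cut ha
      ((contractRel_left (contractRel_symm h.pair.symm _ _ h1)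
        (by rintro rfl; simp [hvA] at ha)).imp (h.pair.symm _ _)
          fun ⟨j, hj, hjp⟩ => ⟨j, hj, h.pair.symm _ _ hjp⟩)
    refine h.pair.nonadj (a := c) (a' := a') (b := d) (b' := b') ?_ ?_ ?_ ?_ ?_ ?_ hcd hr ?_
      (hm.union hm' ?_)
    all_goals clear h real h1 h2 hm hm' hr hcd
    · grind
    · grind
    · grind
    · grind
    · grind
    · grind
    · simp only [Finset.mem_sdiff, Finset.mem_insert, Finset.mem_inter] at ha ha' hb' hc hd
      have hcA : c ∈ A := by grind
      have hdB : d ∈ B := by grind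
      ext z
      have hz1 := hJ z
      have hz2 := @hAB z
      simp only [Finset.mem_sdiff, Finset.mem_insert, Finset.mem_union, Finset.mem_singleton]
      by_cases hz : z ∈ J
      · have n1 : z ≠ a' := by rintro rfl; exact ha'.2 hz
        have n2 : z ≠ b' := by rintro rfl; exact hb'.2 hz
        simp [hz, hz1 hz, n1, n2]
      by_cases hza : z = a
      · subst hza
        have n1 : z ≠ b' := by rintro rfl; exact hz2 ha.1 hb'.1
        have n2 : z ≠ d := by rintro rfl; exact hz2 ha.1 hdB
        simp [ha, n1, n2, haa]
      by_cases hzv : z = v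
      · subst hzv
        have n1 : z ≠ a' := by rintro rfl; exact hvA ha'.1
        have n2 : z ≠ c := by rintro rfl; exact hvA hcA
        simp [hvB, n1, n2, hbv, hvJ]
      have n1 : z ≠ c := by
        rintro rfl
        rcases hc with hc | hc
        exacts [hza hc, hz hc.1]
      have n2 : z ≠ d := by
        rintro rfl
        rcases hd with hd | hd
        exacts [hzv hd, hz hd.1]
      simp [hz, hza, hzv, n1, n2]
    · rw [Finset.disjoint_left]; grind
  refine ⟨contractRel_symm h.pair.symm, ?_, fun a ha => (h.crit_contract_left ha).contractRel,
    fun b hb => (h.crit_contract_right hb).contractRel, ?_, ?_, ?_⟩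
  · clear h key real; rw [Finset.disjoint_left]; grind
  · intro a ha
    rw [Finset.mem_sdiff] at ha
    obtain ⟨b, hb, hab⟩ := h.pair.cutA a ha.1
    by_cases hbJ : b ∈ J
    · exact ⟨v, by simp [hvB, hvJ], .inr (.inr ⟨rfl, b, hbJ, hab⟩)⟩
    · exact ⟨b, by simp [hb, hbJ], .inl hab⟩
  · intro b hb
    rw [Finset.mem_sdiff] at hb
    obtain ⟨a, ha, hba⟩ := h.pair.cutB b hb.1
    by_cases haJ : a ∈ J
    · obtain ⟨j, hj, u, hu, hju⟩ := h.exists_adj (a := a) (by simp [ha, haJ])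
      refine ⟨u, hu, .inr (.inl ⟨?_, j, hj, hju⟩)⟩
      rcases h.adj a haJ b (.inr hb.1) (h.pair.symm _ _ hba) with h1 | h1 | h1
      · exact absurd h1 hb.2
      · exact absurd hb.1 (hAB (hUA h1))
      · exact h1
    · exact ⟨a, by simp [ha, haJ], .inl hba⟩
  · intro a ha a' ha' b hb b' hb' haa hbb h1 h2 hm
    by_cases hbv : b = v
    · subst hbv
      exact key a ha a' ha' b' hb' haa hbb h1 h2 (hm.of_contractRel (by simp))
    by_cases hbv' : b' = v
    · subst hbv'
      refine key a' ha' a ha b hb haa.symm hbb.symm h2 h1 ?_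
      convert hm.of_contractRel (by simp) using 1
      clear key real h hm; grind
    obtain ⟨p, hp, hpv, hvp, hm'⟩ := hm.of_contractRel_mem h.pair.symm
      (by clear key h real hm; grind)
    have hm2 := h.lift_edge (p := p) (by clear key h real hm hm' hvp; grind)
      (by clear key h real hm hm' hvp; grind) hpv hvp
    refine h.pair.nonadj (a := a) (a' := a') (b := b) (b' := b') ?_ ?_ ?_ ?_ haa hbb
      (real a ha b hb hbv h1) (real a' ha' b' hb' hbv' h2) ?_ (hm'.union hm2 ?_)
    all_goals clear h key real h1 h2 hm hm' hm2 hvp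
    · grind
    · grind
    · grind
    · grind
    · ext z
      have := hJ z
      by_cases hz : z ∈ J
      · grind
      · grind
    · rw [Finset.disjoint_left]; grind

end Attached

end TightPair

section OddCycle

variable {V : Type*} [DecidableEq V]

theorem Matchable.image {W : Type*} [DecidableEq W] {Q : W → W → Prop} {R : V → V → Prop}
    {T : Finset W} (f : W → V) (hT : Matchable Q T) :
    (∀ i ∈ T, ∀ j ∈ T, f i = f j → i = j) → (∀ i ∈ T, ∀ j ∈ T, Q i j → R (f i) (f j)) →
    Matchable R (T.image f) := by
  induction hT with
  | empty => intro _ _; simpa using Matchable.empty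
  | @pair a b S ha hb hab h hS ih =>
    intro hf hQ
    rw [Finset.image_insert, Finset.image_insert]
    refine .pair ?_ ?_ ?_ (hQ a (by simp) b (by simp) h) (ih ?_ ?_)
    · intro h'
      obtain ⟨c, hc, hca⟩ := Finset.mem_image.1 h'
      exact ha (hf c (by simp [hc]) a (by simp) hca ▸ hc)
    · intro h'
      obtain ⟨c, hc, hcb⟩ := Finset.mem_image.1 h'
      exact hb (hf c (by simp [hc]) b (by simp) hcb ▸ hc)
    · exact fun h' => hab (hf a (by simp) b (by simp) h')
    · exact fun i hi j hj => hf i (by simp [hi]) j (by simp [hj])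
    · exact fun i hi j hj => hQ i (by simp [hi]) j (by simp [hj])

theorem matchable_Ioo (p : ℤ) (k : ℕ) :
    Matchable (fun i j : ℤ => j = i + 1) (Finset.Ioo p (p + 2 * k + 1)) := by
  induction k with
  | zero =>
    rw [show Finset.Ioo p (p + 2 * (0 : ℕ) + 1) = ∅ by ext z; simp]
    exact .empty
  | succ k ih =>
    refine Matchable.add_pair (a := p + 2 * k + 1) (b := p + 2 * k + 2) ?_ ?_ ?_ ?_ ?_
    · rw [Finset.mem_Ioo]; push_cast; omega
    · rw [Finset.mem_Ioo]; push_cast; omega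
    · omega
    · ring
    · convert ih using 1
      ext z
      simp
      omega

theorem matchable_Ioo_of_odd {p q : ℤ} (h : p < q) (ho : Odd (q - p)) :
    Matchable (fun i j : ℤ => j = i + 1) (Finset.Ioo p q) := by
  obtain ⟨k, hk⟩ := ho
  have := matchable_Ioo p k.toNat
  convert this using 2
  omega

/-- `f` winds around a Hamiltonian cycle of `A` of odd length `n`. -/
structure OddCycle (R : V → V → Prop) (A : Finset V) (n : ℕ) (f : ℤ → V) : Prop where
  odd : Odd n
  three : 3 ≤ n
  inj : ∀ i j, f i = f j ↔ (n : ℤ) ∣ i - j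
  mem : ∀ x, x ∈ A ↔ ∃ i, f i = x
  adj : ∀ i, R (f i) (f (i + 1))

namespace OddCycle

variable {R : V → V → Prop} {A : Finset V} {n : ℕ} {f : ℤ → V}

omit [DecidableEq V] in
theorem rebase (h : OddCycle R A n f) (s : ℤ) : OddCycle R A n (fun i => f (s + i)) where
  odd := h.odd
  three := h.three
  inj i j := by rw [h.inj]; ring_nf
  mem x := by
    rw [h.mem]
    exact ⟨fun ⟨i, hi⟩ => ⟨i - s, by simpa using hi⟩, fun ⟨i, hi⟩ => ⟨s + i, hi⟩⟩
  adj i := by simpa [add_assoc] using h.adj (s + i)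

omit [DecidableEq V] in
theorem reflect (hR : ∀ a b, R a b → R b a) (h : OddCycle R A n f) :
    OddCycle R A n (fun i => f (-i)) where
  odd := h.odd
  three := h.three
  inj i j := by
    rw [h.inj, ← dvd_neg]
    ring_nf
  mem x := by
    rw [h.mem]
    exact ⟨fun ⟨i, hi⟩ => ⟨-i, by simpa using hi⟩, fun ⟨i, hi⟩ => ⟨-i, hi⟩⟩
  adj i := by
    have := hR _ _ (h.adj (-(i + 1)))
    simpa using this

omit [DecidableEq V] in
theorem apply_mem (h : OddCycle R A n f) (i : ℤ) : f i ∈ A := (h.mem _).2 ⟨i, rfl⟩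

omit [DecidableEq V] in
theorem sub_period (h : OddCycle R A n f) (i : ℤ) : f (n - i) = f (-i) := by
  rw [h.inj]; ring_nf; simp

omit [DecidableEq V] in
theorem ne (h : OddCycle R A n f) {i j : ℤ} (hi : 0 ≤ i) (hij : i < j) (hj : j < n) :
    f i ≠ f j := by
  rw [Ne, h.inj]
  intro hd
  have := Int.eq_zero_of_abs_lt_dvd hd (by rw [abs_lt]; omega)
  omega

omit [DecidableEq V] in
theorem exists_index (h : OddCycle R A n f) {x : V} (hx : x ∈ A) (h0 : x ≠ f 0) :
    ∃ i : ℤ, 0 < i ∧ i < n ∧ f i = x := by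
  obtain ⟨i, rfl⟩ := (h.mem x).1 hx
  have hn : (0 : ℤ) < n := by have := h.three; omega
  have hfi : f (i % n) = f i := by
    rw [h.inj]
    exact (Int.mod_modEq i n).symm.dvd
  have h1 := Int.emod_nonneg i hn.ne'
  have h2 : i % n ≠ 0 := by
    intro h2
    rw [h2] at hfi
    exact h0 hfi.symm
  exact ⟨i % n, by omega, Int.emod_lt_of_pos i hn, hfi⟩

theorem matchable_sdiff (h : OddCycle R A n f) {T D : Finset ℤ}
    (hT : Matchable (fun i j : ℤ => j = i + 1) T) (hd : ∀ i, i ∈ T ↔ 0 ≤ i ∧ i < n ∧ i ∉ D)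
    (hD : ∀ i ∈ D, 0 ≤ i ∧ i < n) : Matchable R (A \ D.image f) := by
  have hinj : ∀ i j : ℤ, 0 ≤ i → i < n → 0 ≤ j → j < n → f i = f j → i = j := by
    intro i j hi hi' hj hj' hij
    by_contra hne
    rcases lt_or_gt_of_ne hne with hl | hl
    · exact h.ne hi hl hj' hij
    · exact h.ne hj hl hi' hij.symm
  have hm := hT.image (R := R) f
    (fun i hi j hj => hinj i j ((hd i).1 hi).1 ((hd i).1 hi).2.1 ((hd j).1 hj).1 ((hd j).1 hj).2.1)
    (by rintro i - _ - rfl; exact h.adj i)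
  convert hm using 1
  ext x
  simp only [Finset.mem_sdiff, Finset.mem_image, not_exists, not_and]
  constructor
  · rintro ⟨hx, hxD⟩
    by_cases hx0 : x = f 0
    · subst hx0
      have := h.three
      exact ⟨0, (hd 0).2 ⟨le_rfl, by omega, fun h0 => hxD 0 h0 rfl⟩, rfl⟩
    · obtain ⟨i, h1, h2, rfl⟩ := h.exists_index hx hx0
      exact ⟨i, (hd i).2 ⟨h1.le, h2, fun h0 => hxD i h0 rfl⟩, rfl⟩
  · rintro ⟨i, hi, rfl⟩
    obtain ⟨h1, h2, h3⟩ := (hd i).1 hi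
    refine ⟨h.apply_mem i, fun j hj hij => h3 ?_⟩
    rw [← hinj j i (hD j hj).1 (hD j hj).2 h1 h2 hij]
    exact hj

theorem matchable_sdiff_one (h : OddCycle R A n f) (s : ℤ) : Matchable R (A \ {f s}) := by
  have hn := h.three
  have := (h.rebase s).matchable_sdiff (D := {0})
    (matchable_Ioo_of_odd (p := 0) (q := n) (by omega) (by simpa using h.odd))
    (by intro i; simp; omega) (by simp; omega)
  simpa using this

theorem matchable_sdiff_three (h : OddCycle R A n f) {i j : ℤ} (hi : 0 < i) (hij : i < j)
    (hj : j < n) (oi : Odd i) (ej : Even j) : Matchable R (A \ {f 0, f i, f j}) := by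
  have hn : Odd (n : ℤ) := by simpa using h.odd
  have := h.matchable_sdiff (D := {0, i, j})
    (((matchable_Ioo_of_odd hi (by simpa using oi)).union
      (matchable_Ioo_of_odd hij (by grind)) (by
        rw [Finset.disjoint_left]; intro z; simp; omega)).union
      (matchable_Ioo_of_odd hj (by grind)) (by
        rw [Finset.disjoint_left]; intro z; simp; omega))
    (by intro z; simp; omega) (by simp; omega)
  simpa using this

theorem matchable_sdiff_five (h : OddCycle R A n f) {i j k l : ℤ} (hi : 0 < i) (hij : i < j)
    (hjk : j < k) (hkl : k < l) (hl : l < n) (oi : Odd i) (ej : Even j) (ok : Odd k)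
    (el : Even l) : Matchable R (A \ {f 0, f i, f j, f k, f l}) := by
  have hn : Odd (n : ℤ) := by simpa using h.odd
  have := h.matchable_sdiff (D := {0, i, j, k, l})
    (((((matchable_Ioo_of_odd hi (by simpa using oi)).union
      (matchable_Ioo_of_odd hij (by grind)) (by
        rw [Finset.disjoint_left]; intro z; simp; omega)).union
      (matchable_Ioo_of_odd hjk (by grind)) (by
        rw [Finset.disjoint_left]; intro z; simp; omega)).union
      (matchable_Ioo_of_odd hkl (by grind)) (by
        rw [Finset.disjoint_left]; intro z; simp; omega)).union
      (matchable_Ioo_of_odd hl (by grind)) (by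
        rw [Finset.disjoint_left]; intro z; simp; omega))
    (by intro z; simp; omega) (by simp; omega)
  simpa using this

theorem of_list (L : List V) (h3 : 3 ≤ L.length) (ho : Odd L.length) (hnd : L.Nodup)
    (hch : L.IsChain R) (hlast : R (L.getLast (by rintro rfl; simp at h3)) (L[0]'(by omega))) :
    ∃ f, OddCycle R L.toFinset L.length f := by
  have hpos : (0 : ℤ) < L.length := by omega
  have hlt : ∀ i : ℤ, (i % L.length).toNat < L.length := by
    intro i
    have h1 := Int.emod_nonneg i hpos.ne'
    have h2 := Int.emod_lt_of_pos i hpos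
    omega
  refine ⟨fun i => L[(i % L.length).toNat]'(hlt i), ho, h3, ?_, ?_, ?_⟩
  · intro i j
    rw [hnd.getElem_inj_iff]
    have h1 := Int.emod_nonneg i hpos.ne'
    have h2 := Int.emod_nonneg j hpos.ne'
    constructor
    · intro h
      have : i % L.length = j % L.length := by omega
      exact Int.ModEq.dvd (a := j) (b := i) this.symm
    · intro h
      have : j % L.length = i % L.length := (Int.modEq_iff_dvd.2 h)
      rw [this]
  · intro x
    rw [List.mem_toFinset, List.mem_iff_getElem]
    constructor
    · rintro ⟨k, hk, rfl⟩
      refine ⟨k, ?_⟩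
      congr 1
      rw [Int.emod_eq_of_lt (by omega) (by omega)]
      simp
    · rintro ⟨i, rfl⟩
      exact ⟨_, hlt i, rfl⟩
  · intro i
    have h1 := Int.emod_nonneg i hpos.ne'
    have h2 := Int.emod_lt_of_pos i hpos
    by_cases hi : i % L.length + 1 < L.length
    · have h4 : (i + 1) % L.length = i % L.length + 1 := by
        rw [← Int.emod_add_emod, Int.emod_eq_of_lt (by omega) hi]
      have := List.isChain_iff_getElem.1 hch (i % L.length).toNat (by omega)
      convert this using 2
      rw [h4]; omega
    · have h4 : (i + 1) % L.length = 0 := by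
        rw [← Int.emod_add_emod]
        have : i % L.length + 1 = L.length := by omega
        rw [this, Int.emod_self]
      convert hlast using 1
      · rw [List.getLast_eq_getElem]
        congr 1
        omega
      · congr 1
        rw [h4]; rfl

end OddCycle

/-- A factor-critical set contains an odd cycle with matchable complement. -/
theorem exists_oddCycle {R : V → V → Prop} {A : Finset V} (hR : ∀ a b, R a b → R b a)
    (hA : ∀ a ∈ A, Matchable R (A \ {a})) (h3 : 3 ≤ A.card) :
    ∃ O ⊆ A, Matchable R (A \ O) ∧ ∃ n f, 3 ≤ O.card ∧ OddCycle R O n f := by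
  obtain ⟨y, hy⟩ : A.Nonempty := Finset.card_pos.1 (by omega)
  obtain ⟨a, ha⟩ : (A \ {y}).Nonempty := Finset.card_pos.1 (by
    rw [Finset.card_sdiff_of_subset (by simpa using hy)]; simp; omega)
  obtain ⟨x, hx, hxa, hax, -⟩ := (hA y hy).remove hR a ha
  rw [Finset.mem_sdiff] at ha hx
  obtain ⟨l, h1, h2, h4, h5, h6, h7⟩ := Matchable.exists_path hR (a := a) _ (A \ {a}) rfl (by simp)
    (hA a ha.1) x (by simp [hx, hxa]) (by
      convert hA x hx.1 using 1
      clear h3 hA; grind)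
  have hmem : ∀ z ∈ x :: l, z ∈ A ∧ z ≠ a := by simpa using h1
  have hcard : 3 ≤ (a :: x :: l).length := by
    simp only [List.length_cons] at h5 ⊢
    rcases l with _ | ⟨_, _⟩
    · simp at h5
    · simp
  have hnd : (a :: x :: l).Nodup := List.nodup_cons.2 ⟨fun h => (hmem a h).2 rfl, h2⟩
  obtain ⟨f, hf⟩ := OddCycle.of_list (R := R) (a :: x :: l) hcard
    (by rw [List.length_cons]; exact h5.add_one) hnd
    (by rw [List.isChain_cons_cons]; exact ⟨hax, h4⟩) (by simpa using h6)
  refine ⟨_, ?_, ?_, _, f, ?_, hf⟩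
  · intro z hz
    rw [List.mem_toFinset, List.mem_cons] at hz
    rcases hz with rfl | hz
    exacts [ha.1, (hmem z hz).1]
  · convert h7 using 1
    ext z; simp; tauto
  · rwa [List.toFinset_card_of_nodup hnd]

end OddCycle

section Leaves

variable {V : Type*} [DecidableEq V] {R : V → V → Prop} {A B : Finset V}

namespace TightPair

theorem no_three (h : TightPair R A B) {a₁ a₂ a₃ b₁ b₂ b₃ : V} {T : Finset V}
    (ha₁ : a₁ ∈ A) (ha₂ : a₂ ∈ A) (ha₃ : a₃ ∈ A) (hb₁ : b₁ ∈ B) (hb₂ : b₂ ∈ B) (hb₃ : b₃ ∈ B)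
    (ha12 : a₁ ≠ a₂) (ha13 : a₁ ≠ a₃) (ha23 : a₂ ≠ a₃) (hb12 : b₁ ≠ b₂) (hb13 : b₁ ≠ b₃)
    (hb23 : b₂ ≠ b₃) (h₁ : R a₁ b₁) (h₂ : R a₂ b₂) (h₃ : R a₃ b₃)
    (hA : Matchable R (A \ {a₁, a₂, a₃})) (hT : ∀ x, x ∈ T ↔ x = b₁ ∨ x = b₂ ∨ x = b₃)
    (hB : Matchable R (B \ T)) : False := by
  have hAB := Finset.disjoint_left.1 h.disj
  refine h.nonadj ha₁ ha₂ hb₁ hb₂ ha12 hb12 h₁ h₂ rfl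
    (Matchable.add_pair (a := a₃) (b := b₃) ?_ ?_ ?_ h₃ ?_)
  · clear h hA hB h₁ h₂ h₃; grind
  · clear h hA hB h₁ h₂ h₃; grind
  · clear h hA hB h₁ h₂ h₃; grind
  · have e : T = {b₁, b₂, b₃} := by ext x; simp [hT]
    subst e
    convert hA.union hB ?_ using 1
    · clear h hA hB h₁ h₂ h₃
      ext z
      by_cases hz : z ∈ A
      · have hz' := hAB hz
        have n1 : z ≠ b₁ := by rintro rfl; exact hz' hb₁
        have n2 : z ≠ b₂ := by rintro rfl; exact hz' hb₂
        have n3 : z ≠ b₃ := by rintro rfl; exact hz' hb₃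
        simp [hz, hz', n1, n2, n3, and_assoc]
      · have n1 : z ≠ a₁ := by rintro rfl; exact hz ha₁
        have n2 : z ≠ a₂ := by rintro rfl; exact hz ha₂
        have n3 : z ≠ a₃ := by rintro rfl; exact hz ha₃
        simp [hz, n1, n2, n3, and_assoc]
    · rw [Finset.disjoint_left]
      intro z hz hz'
      exact hAB (Finset.mem_sdiff.1 hz).1 (Finset.mem_sdiff.1 hz').1

variable {n m : ℕ} {f g : ℤ → V}

/-- Three disjoint cut edges in alternating position on both cycles. -/
theorem no_three_cycle (h : TightPair R A B) (hf : OddCycle R A n f) (hg : OddCycle R B m g)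
    {i j p q : ℤ} {x y z : V} {T : Finset V} (hi : 0 < i) (hij : i < j) (hj : j < n)
    (oi : Odd i) (ej : Even j) (hp : 0 < p) (hpq : p < q) (hq : q < m) (op : Odd p) (eq : Even q)
    (hT : T = {g 0, g p, g q}) (hxyz : ∀ w, w ∈ T ↔ w = x ∨ w = y ∨ w = z)
    (hxy : x ≠ y) (hxz : x ≠ z) (hyz : y ≠ z)
    (h₁ : R (f 0) x) (h₂ : R (f i) y) (h₃ : R (f j) z) : False := by
  have hTB : ∀ w ∈ T, w ∈ B := by
    subst hT
    intro w hw
    simp only [Finset.mem_insert, Finset.mem_singleton] at hw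
    rcases hw with rfl | rfl | rfl <;> exact hg.apply_mem _
  exact h.no_three (hf.apply_mem 0) (hf.apply_mem i) (hf.apply_mem j)
    (hTB x ((hxyz x).2 (by simp))) (hTB y ((hxyz y).2 (by simp))) (hTB z ((hxyz z).2 (by simp)))
    (hf.ne le_rfl hi (by omega)) (hf.ne le_rfl (by omega) hj) (hf.ne hi.le hij hj)
    hxy hxz hyz h₁ h₂ h₃ (hf.matchable_sdiff_three hi hij hj oi ej) hxyz
    (hT ▸ hg.matchable_sdiff_three hp hpq hq op eq)

theorem no_cross_of_odd (h : TightPair R A B) (hf : OddCycle R A n f) (hg : OddCycle R B m g)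
    {i' j' j j2 : ℤ} (h0 : R (f 0) (g 0)) (hi0 : 0 < i') (hi : i' < m) (h1 : R (f 1) (g i'))
    (hj0' : 0 < j') (hj' : j' < m) (h2 : R (f (n - 1)) (g j'))
    (hj0 : 0 < j) (hj : j < n) (h3 : R (f j) (g 1))
    (hj20 : 0 < j2) (hj2 : j2 < n) (h4 : R (f j2) (g (m - 1))) (oi : Odd i') : False := by
  have on : Odd (n : ℤ) := by simpa using hf.odd
  have om : Odd (m : ℤ) := by simpa using hg.odd
  have hn := hf.three
  have hm := hg.three
  have en : Even ((n : ℤ) - 1) := on.sub_odd odd_one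
  have em : Even ((m : ℤ) - 1) := om.sub_odd odd_one
  have oj2 : Odd j2 := by
    by_contra hc
    rw [Int.not_odd_iff_even] at hc
    have : j2 ≠ 1 := by rintro rfl; simp at hc
    have : i' ≠ m - 1 := by rintro rfl; rw [← Int.not_even_iff_odd] at oi; exact oi em
    exact h.no_three_cycle hf hg (i := 1) (j := j2) (p := i') (q := m - 1) one_pos (by omega) hj2
      odd_one hc hi0 (by omega) (by omega) oi em rfl (by simp)
      (hg.ne le_rfl hi0 hi) (hg.ne le_rfl (by omega) (by omega))
      (hg.ne hi0.le (by omega) (by omega)) h0 h1 h4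
  have hj2n : j2 < n - 1 := by
    have : j2 ≠ n - 1 := by rintro rfl; rw [← Int.not_even_iff_odd] at oj2; exact oj2 en
    omega
  have ej' : Even j' := by
    by_contra hc
    rw [Int.not_even_iff_odd] at hc
    have : j' ≠ m - 1 := by rintro rfl; rw [← Int.not_even_iff_odd] at hc; exact hc em
    exact h.no_three_cycle hf hg (i := j2) (j := n - 1) (p := j') (q := m - 1) hj20 hj2n (by omega)
      oj2 en hj0' (by omega) (by omega) hc em rfl (by intro w; simp; tauto)
      (hg.ne le_rfl (by omega) (by omega)) (hg.ne le_rfl hj0' hj')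
      (hg.ne hj0'.le (by omega) (by omega)).symm h0 h4 h2
  have hne : i' ≠ j' := by rintro rfl; rw [← Int.not_even_iff_odd] at oi; exact oi ej'
  have hlt : j' < i' := by
    by_contra hc
    exact h.no_three_cycle hf hg (i := 1) (j := n - 1) (p := i') (q := j') one_pos (by omega)
      (by omega) odd_one en hi0 (by omega) hj' oi ej' rfl (by simp)
      (hg.ne le_rfl hi0 hi) (hg.ne le_rfl hj0' hj')
      (hg.ne hi0.le (by omega) (by omega)) h0 h1 h2
  have hj1 : 1 < j' := by
    have : j' ≠ 1 := by rintro rfl; simp at ej'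
    omega
  have ej : Even j := by
    by_contra hc
    rw [Int.not_even_iff_odd] at hc
    have : j ≠ n - 1 := by rintro rfl; rw [← Int.not_even_iff_odd] at hc; exact hc en
    exact h.no_three_cycle hf hg (i := j) (j := n - 1) (p := 1) (q := j') hj0 (by omega)
      (by omega) hc en one_pos hj1 hj' odd_one ej' rfl (by simp)
      (hg.ne le_rfl one_pos (by omega)) (hg.ne le_rfl hj0' hj')
      (hg.ne zero_le_one hj1 hj') h0 h3 h2
  have hjj : j ≠ j2 := by rintro rfl; rw [← Int.not_even_iff_odd] at oj2; exact oj2 ej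
  have hjlt : j < j2 := by
    by_contra hc
    exact h.no_three_cycle hf hg (i := j2) (j := j) (p := 1) (q := m - 1) hj20 (by omega)
      hj oj2 ej one_pos (by omega) (by omega) odd_one em rfl (by intro w; simp; tauto)
      (hg.ne le_rfl (by omega) (by omega)) (hg.ne le_rfl one_pos (by omega))
      (hg.ne zero_le_one (by omega) (by omega)).symm h0 h4 h3
  have hj1' : 1 < j := by
    have : j ≠ 1 := by rintro rfl; simp at ej
    omega
  have him : i' < m - 1 := by
    have : i' ≠ m - 1 := by rintro rfl; rw [← Int.not_even_iff_odd] at oi; exact oi em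
    omega
  have hA := hf.matchable_sdiff_five (i := 1) (j := j) (k := j2) (l := n - 1) one_pos hj1' hjlt hj2n
    (by omega) odd_one ej oj2 en
  have hB := hg.matchable_sdiff_five (i := 1) (j := j') (k := i') (l := m - 1) one_pos hj1 hlt him
    (by omega) odd_one ej' oi em
  have fA := hf.apply_mem
  have gB := hg.apply_mem
  have hAB := Finset.disjoint_left.1 h.disj
  have dAB : ∀ s t, f s ≠ g t := fun s t he => hAB (fA s) (he ▸ gB t)
  have inA : ∀ s t : ℤ, 0 ≤ s → s < t → t < n → f s ≠ f t := fun s t h1 h2 h3 => hf.ne h1 h2 h3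
  have inB : ∀ s t : ℤ, 0 ≤ s → s < t → t < m → g s ≠ g t := fun s t h1 h2 h3 => hg.ne h1 h2 h3
  have a1 := inA 0 1 (by omega) (by omega) (by omega)
  have a2 := inA 0 j (by omega) (by omega) (by omega)
  have a3 := inA 0 j2 (by omega) (by omega) (by omega)
  have a4 := inA 0 (n - 1) (by omega) (by omega) (by omega)
  have a5 := inA 1 j (by omega) (by omega) (by omega)
  have a6 := inA 1 j2 (by omega) (by omega) (by omega)
  have a7 := inA 1 (n - 1) (by omega) (by omega) (by omega)
  have a8 := inA j j2 (by omega) (by omega) (by omega)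
  have a9 := inA j (n - 1) (by omega) (by omega) (by omega)
  have a10 := inA j2 (n - 1) (by omega) (by omega) (by omega)
  have b1 := inB 0 1 (by omega) (by omega) (by omega)
  have b2 := inB 0 j' (by omega) (by omega) (by omega)
  have b3 := inB 0 i' (by omega) (by omega) (by omega)
  have b4 := inB 0 (m - 1) (by omega) (by omega) (by omega)
  have b5 := inB 1 j' (by omega) (by omega) (by omega)
  have b6 := inB 1 i' (by omega) (by omega) (by omega)
  have b7 := inB 1 (m - 1) (by omega) (by omega) (by omega)
  have b8 := inB j' i' (by omega) (by omega) (by omega)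
  have b9 := inB j' (m - 1) (by omega) (by omega) (by omega)
  have b10 := inB i' (m - 1) (by omega) (by omega) (by omega)
  refine h.nonadj (fA 0) (fA 1) (gB 0) (gB i') a1 b3 h0 h1 rfl
    (Matchable.add_pair (a := f (n - 1)) (b := g j') ?_ ?_ (dAB _ _) h2
    (Matchable.add_pair (a := f j) (b := g 1) ?_ ?_ (dAB _ _) h3
    (Matchable.add_pair (a := f j2) (b := g (m - 1)) ?_ ?_ (dAB _ _) h4 ?_)))
  · simp [fA, (dAB _ _), a4.symm, a7.symm]
  · simp [gB, (dAB _ _).symm, b2.symm, b8]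
  · simp [fA, (dAB _ _), a2.symm, a5.symm, a9]
  · simp [gB, (dAB _ _).symm, b1.symm, b6, b5]
  · simp [fA, (dAB _ _), a3.symm, a6.symm, a8.symm, a10]
  · simp [gB, (dAB _ _).symm, b4.symm, b7.symm, b9.symm, b10.symm]
  · convert hA.union hB ?_ using 1
    · ext z
      by_cases hz : z ∈ A
      · have hz' : ∀ t, z ≠ g t := by rintro t rfl; exact hAB hz (gB t)
        simp only [Finset.mem_sdiff, Finset.mem_union, Finset.mem_insert, Finset.mem_singleton, hz,
          hz', hAB hz]
        tauto
      · have hz' : ∀ t, z ≠ f t := by rintro t rfl; exact hz (fA t)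
        simp only [Finset.mem_sdiff, Finset.mem_union, Finset.mem_insert, Finset.mem_singleton, hz,
          hz']
        tauto
    · rw [Finset.disjoint_left]
      intro z hz hz'
      exact hAB (Finset.mem_sdiff.1 hz).1 (Finset.mem_sdiff.1 hz').1

theorem no_cross (h : TightPair R A B) (hf : OddCycle R A n f) (hg : OddCycle R B m g)
    {b b' a a' : V} (h0 : R (f 0) (g 0)) (hb : b ∈ B) (hb0 : b ≠ g 0) (h1 : R (f 1) b)
    (hb' : b' ∈ B) (hb0' : b' ≠ g 0) (h2 : R (f (-1)) b')
    (ha : a ∈ A) (ha0 : a ≠ f 0) (h3 : R (g 1) a)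
    (ha' : a' ∈ A) (ha0' : a' ≠ f 0) (h4 : R (g (-1)) a') : False := by
  obtain ⟨i', hi0, hi, rfl⟩ := hg.exists_index hb hb0
  obtain ⟨j', hj0', hj', rfl⟩ := hg.exists_index hb' hb0'
  obtain ⟨j, hj0, hj, rfl⟩ := hf.exists_index ha ha0
  obtain ⟨j2, hj20, hj2, rfl⟩ := hf.exists_index ha' ha0'
  replace h3 := h.symm _ _ h3
  replace h4 := h.symm _ _ h4
  rw [← hf.sub_period] at h2
  by_cases oi : Odd i'
  · rw [← hg.sub_period] at h4
    exact h.no_cross_of_odd hf hg h0 hi0 hi h1 hj0' hj' h2 hj0 hj h3 hj20 hj2 h4 oi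
  · rw [Int.not_odd_iff_even] at oi
    have om : Odd (m : ℤ) := by simpa using hg.odd
    have e : ∀ t, g (-(m - t)) = g t := by
      intro t
      rw [hg.inj]
      ring_nf
      simp
    refine h.no_cross_of_odd hf (hg.reflect h.symm) (i' := m - i') (j' := m - j') (j := j2)
      (j2 := j) (by simpa using h0) (by omega) (by omega) (by simpa only [e] using h1) (by omega)
      (by omega) (by simpa only [e] using h2) hj20 hj2 h4 hj0 hj (by simpa only [e] using h3)
      (om.sub_even oi)

/-- All neighbours of `x` in `B` equal `y`. -/
structure Leaf (R : V → V → Prop) (B : Finset V) (x y : V) : Prop where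
  adj : R x y
  unique : ∀ b ∈ B, R x b → b = y

theorem exists_leaf (h : TightPair R A B) (hf : OddCycle R A n f) (hg : OddCycle R B m g)
    {s t : ℤ} (h0 : R (f s) (g t)) :
    (Leaf R B (f (s + 1)) (g t) ∨ Leaf R B (f (s - 1)) (g t)) ∨
    (Leaf R A (g (t + 1)) (f s) ∨ Leaf R A (g (t - 1)) (f s)) := by
  have leaf : ∀ {A B : Finset V} (_ : TightPair R A B) (x y : V), x ∈ A → ¬ Leaf R B x y →
      ∃ b ∈ B, b ≠ y ∧ R x b := by
    intro A B h x y hx hl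
    by_contra! hno
    obtain ⟨b, hb, hxb⟩ := h.cutA x hx
    refine hl ⟨?_, fun b hb hxb => by_contra fun hne => hno b hb hne hxb⟩
    rwa [by_contra fun hne => hno b hb hne hxb] at hxb
  by_contra! hno
  obtain ⟨⟨n1, n2⟩, n3, n4⟩ := hno
  obtain ⟨b, hb, hb0, h1⟩ := leaf h _ _ (hf.apply_mem _) n1
  obtain ⟨b', hb', hb0', h2⟩ := leaf h _ _ (hf.apply_mem _) n2
  obtain ⟨a, ha, ha0, h3⟩ := leaf h.swap _ _ (hg.apply_mem _) n3
  obtain ⟨a', ha', ha0', h4⟩ := leaf h.swap _ _ (hg.apply_mem _) n4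
  exact h.no_cross (hf.rebase s) (hg.rebase t) (by simpa using h0) hb (by simpa using hb0) h1
    hb' (by simpa using hb0') h2 ha (by simpa using ha0) h3 ha' (by simpa using ha0') h4

theorem exists_leaf_pair (h : TightPair R A B) (hf : OddCycle R A n f) (hg : OddCycle R B m g)
    {x y : V} (hx : x ∈ A) (hy : y ∈ B) (hl : Leaf R B x y) :
    ∃ s, Leaf R B (f s) y ∧ Leaf R B (f (s + 1)) y := by
  obtain ⟨s, rfl⟩ := (hf.mem x).1 hx
  obtain ⟨t, rfl⟩ := (hg.mem y).1 hy
  have hm := hg.three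
  have not_leaf : ∀ t', g t' ≠ g t → ¬ Leaf R A (g t') (f s) := fun t' hne hl' =>
    hne (hl.unique _ (hg.apply_mem t') (h.symm _ _ hl'.adj))
  have h1 : g (t + 1) ≠ g t := by
    rw [Ne, hg.inj]
    intro hd
    have := Int.le_of_dvd (by omega) hd
    omega
  have h2 : g (t - 1) ≠ g t := by
    rw [Ne, hg.inj, ← dvd_neg]
    intro hd
    have := Int.le_of_dvd (by omega) hd
    omega
  rcases h.exists_leaf hf hg hl.adj with (h' | h') | h' | h'
  · exact ⟨s, hl, h'⟩
  · exact ⟨s - 1, h', by simpa using hl⟩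
  · exact absurd h' (not_leaf _ h1)
  · exact absurd h' (not_leaf _ h2)

theorem exists_leaf_pair_index (h : TightPair R A B) (hf : OddCycle R A n f)
    (hg : OddCycle R B m g) {x y : V} (hx : x ∈ A) (hy : y ∈ B) (hl : Leaf R B x y)
    (h0 : ¬ Leaf R B (f 0) y) :
    ∃ s : ℤ, 0 < s ∧ s + 1 < n ∧ Leaf R B (f s) y ∧ Leaf R B (f (s + 1)) y := by
  obtain ⟨s, h1, h2⟩ := h.exists_leaf_pair hf hg hx hy hl
  have hn := hf.three
  have hn0 : (0 : ℤ) < n := by omega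
  have e1 : f (s % n) = f s := by
    rw [hf.inj]
    exact (Int.mod_modEq s n).symm.dvd
  have e2 : f (s % n + 1) = f (s + 1) := by
    rw [hf.inj, add_sub_add_right_eq_sub]
    exact (Int.mod_modEq s n).symm.dvd
  rw [← e1] at h1
  rw [← e2] at h2
  refine ⟨s % n, ?_, ?_, h1, h2⟩
  · have h3 := Int.emod_nonneg s hn0.ne'
    have h4 : s % n ≠ 0 := fun h4 => h0 (h4 ▸ h1)
    omega
  · have h3 := Int.emod_lt_of_pos s hn0
    have h4 : s % n + 1 ≠ n := by
      intro h4
      rw [h4] at h2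
      refine h0 ?_
      convert h2 using 1
      rw [hf.inj]
      simp
    omega

theorem center_unique (h : TightPair R A B) (hf : OddCycle R A n f) (hg : OddCycle R B m g)
    {x₁ x₂ y₁ y₂ : V} (hx₁ : x₁ ∈ A) (hx₂ : x₂ ∈ A) (hy₁ : y₁ ∈ B) (hy₂ : y₂ ∈ B)
    (h₁ : Leaf R B x₁ y₁) (h₂ : Leaf R B x₂ y₂) : y₁ = y₂ := by
  by_contra hne
  obtain ⟨t, rfl⟩ := (hg.mem y₁).1 hy₁
  obtain ⟨g', hg', hg0, k, hk0, hkm, ek, hgk⟩ : ∃ g', OddCycle R B m g' ∧ g' 0 = g t ∧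
      ∃ k : ℤ, 0 < k ∧ k < m ∧ Even k ∧ g' k = y₂ := by
    have hg' := hg.rebase t
    obtain ⟨k, h1, h2, h3⟩ := hg'.exists_index hy₂ (by simpa using Ne.symm hne)
    by_cases ek : Even k
    · exact ⟨_, hg', by simp, k, h1, h2, ek, h3⟩
    · rw [Int.not_even_iff_odd] at ek
      have om : Odd (m : ℤ) := by simpa using hg.odd
      refine ⟨_, hg'.reflect h.symm, by simp, m - k, by omega, by omega, om.sub_odd ek, ?_⟩
      rw [← h3]
      show g _ = g _
      rw [hg.inj]
      ring_nf
      simp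
  rw [← hg0] at h₁ hne hy₁
  clear hg hg0
  subst hgk
  have hk1 : 1 < k := by
    have : k ≠ 1 := by rintro rfl; simp at ek
    omega
  have n01 : g' 0 ≠ g' 1 := hg'.ne le_rfl one_pos (by omega)
  have n1k : g' 1 ≠ g' k := hg'.ne zero_le_one hk1 hkm
  obtain ⟨x₃, hx₃, h3⟩ := h.cutB (g' 1) (hg'.apply_mem 1)
  obtain ⟨r, rfl⟩ := (hf.mem x₃).1 hx₃
  have hf' := hf.rebase r
  obtain ⟨s, s0, sn, l1, l2⟩ := h.exists_leaf_pair_index hf' hg' hx₁ hy₁ h₁ (fun hl =>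
    n01 (hl.unique _ (hg'.apply_mem 1) (by simpa using h.symm _ _ h3)).symm)
  obtain ⟨u, u0, un, l3, l4⟩ := h.exists_leaf_pair_index hf' hg' hx₂ hy₂ h₂ (fun hl =>
    n1k (hl.unique _ (hg'.apply_mem 1) (by simpa using h.symm _ _ h3)))
  have hdis : ∀ x, Leaf R B x (g' 0) → Leaf R B x (g' k) → False := fun x h1 h2 =>
    hne (h2.unique _ (hg'.apply_mem 0) h1.adj)
  have d1 : s ≠ u := by rintro rfl; exact hdis _ l1 l3
  have d2 : s + 1 ≠ u := by rintro rfl; exact hdis _ l2 l3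
  have d3 : s ≠ u + 1 := by rintro rfl; exact hdis _ l1 l4
  have pick : ∀ (s : ℤ) (y : V), Leaf R B (f (r + s)) y → Leaf R B (f (r + (s + 1))) y →
      (∃ o, s ≤ o ∧ o ≤ s + 1 ∧ Odd o ∧ R (f (r + o)) y) ∧
      (∃ e, s ≤ e ∧ e ≤ s + 1 ∧ Even e ∧ R (f (r + e)) y) := by
    intro s y l1 l2
    rcases Int.even_or_odd s with hs | hs
    · exact ⟨⟨s + 1, by omega, by omega, hs.add_one, l2.adj⟩, ⟨s, by omega, by omega, hs, l1.adj⟩⟩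
    · exact ⟨⟨s, by omega, by omega, hs, l1.adj⟩, ⟨s + 1, by omega, by omega, hs.add_one, l2.adj⟩⟩
  obtain ⟨⟨o1, p1, p2, p3, p4⟩, ⟨e1, p5, p6, p7, p8⟩⟩ := pick s _ l1 l2
  obtain ⟨⟨o2, q1, q2, q3, q4⟩, ⟨e2, q5, q6, q7, q8⟩⟩ := pick u _ l3 l4
  rcases lt_or_ge s u with hlt | hlt
  · exact h.no_three_cycle hf' hg' (i := o1) (j := e2) (p := 1) (q := k) (by omega) (by omega)
      (by omega) p3 q7 one_pos hk1 hkm odd_one ek rfl (by intro w; simp; tauto) n01.symm n1k hne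
      (by simpa using h.symm _ _ h3) p4 q8
  · exact h.no_three_cycle hf' hg' (i := o2) (j := e1) (p := 1) (q := k) (by omega) (by omega)
      (by omega) q3 p7 one_pos hk1 hkm odd_one ek rfl (by intro w; simp; tauto) n1k n01.symm
      (Ne.symm hne) (by simpa using h.symm _ _ h3) q4 p8

/-- If both sides carry Hamiltonian odd cycles, two vertices cover all cut edges. -/
theorem exists_cover (h : TightPair R A B) (hf : OddCycle R A n f) (hg : OddCycle R B m g) :
    ∃ x ∈ A, ∃ y ∈ B, ∀ a ∈ A, ∀ b ∈ B, R a b → a = x ∨ b = y := by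
  obtain ⟨y, hy, hyu⟩ : ∃ y ∈ B, ∀ a ∈ A, ∀ b ∈ B, Leaf R B a b → b = y := by
    by_cases hc : ∃ y ∈ B, ∃ a ∈ A, Leaf R B a y
    · obtain ⟨y, hy, a, ha, hl⟩ := hc
      exact ⟨y, hy, fun a' ha' b hb hl' => h.center_unique hf hg ha' ha hb hy hl' hl⟩
    · push Not at hc
      exact ⟨g 0, hg.apply_mem 0, fun a ha b hb hl => absurd hl (hc b hb a ha)⟩
  obtain ⟨x, hx, hxu⟩ : ∃ x ∈ A, ∀ b ∈ B, ∀ a ∈ A, Leaf R A b a → a = x := by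
    by_cases hc : ∃ x ∈ A, ∃ b ∈ B, Leaf R A b x
    · obtain ⟨x, hx, b, hb, hl⟩ := hc
      exact ⟨x, hx, fun b' hb' a ha hl' => h.swap.center_unique hg hf hb' hb ha hx hl' hl⟩
    · push Not at hc
      exact ⟨f 0, hf.apply_mem 0, fun b hb a ha hl => absurd hl (hc a ha b hb)⟩
  refine ⟨x, hx, y, hy, fun a ha b hb hab => ?_⟩
  obtain ⟨s, rfl⟩ := (hf.mem a).1 ha
  obtain ⟨t, rfl⟩ := (hg.mem b).1 hb
  rcases h.exists_leaf hf hg hab with (h' | h') | h' | h'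
  · exact .inr (hyu _ (hf.apply_mem _) _ hb h')
  · exact .inr (hyu _ (hf.apply_mem _) _ hb h')
  · exact .inl (hxu _ (hg.apply_mem _) _ ha h')
  · exact .inl (hxu _ (hg.apply_mem _) _ ha h')

end TightPair

end Leaves

section Separation

variable {V : Type*} [DecidableEq V]

/-- `I` is nonempty, avoids `x` and `r`, and all neighbours of `I` lie in `I ∪ {x, r}`. -/
structure Side (R : V → V → Prop) (A B : Finset V) (x r : V) (I : Finset V) : Prop where
  nonempty : I.Nonempty
  sub : ∀ i ∈ I, i ∈ A ∨ i ∈ B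
  left : x ∉ I
  right : r ∉ I
  adj : ∀ i ∈ I, ∀ j, j ∈ A ∨ j ∈ B → R i j → j ∈ I ∨ j = x ∨ j = r

/-- Some pair consisting of a vertex of `A` and a vertex of `B` separates `A ∪ B`. -/
def Separated (R : V → V → Prop) (A B : Finset V) : Prop :=
  ∃ x ∈ A, ∃ r ∈ B, ∃ I, Side R A B x r I ∧ ∃ z, (z ∈ A ∨ z ∈ B) ∧ z ∉ I ∧ z ≠ x ∧ z ≠ r

/-- A separation with a side avoiding `w` and contained in `B` in case `w` belongs to the
separating pair. -/
def SeparatedFrom (R : V → V → Prop) (A B : Finset V) (w : V) : Prop :=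
  ∃ x ∈ A, ∃ r ∈ B, ∃ I, Side R A B x r I ∧ w ∉ I ∧ (r ≠ w ∨ I ⊆ B)

variable {R : V → V → Prop} {A B U I J : Finset V} {v w x r : V}

omit [DecidableEq V] in
theorem Side.swap (h : Side R A B x r I) : Side R B A r x I where
  nonempty := h.nonempty
  sub i hi := (h.sub i hi).symm
  left := h.right
  right := h.left
  adj i hi j hj hij := (h.adj i hi j hj.symm hij).imp_right Or.symm

omit [DecidableEq V] in
theorem Separated.swap (h : Separated R A B) : Separated R B A := by
  obtain ⟨x, hx, r, hr, I, hI, z, hz, h1, h2, h3⟩ := h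
  exact ⟨r, hr, x, hx, I, hI.swap, z, hz.symm, h1, h3, h2⟩

namespace TightPair

theorem separated_of_from (h : TightPair R A B) (h3 : 3 ≤ A.card) (hw : w ∈ B)
    (hs : SeparatedFrom R A B w) : Separated R A B := by
  obtain ⟨x, hx, r, hr, I, hI, hwI, hor⟩ := hs
  have hAB := Finset.disjoint_left.1 h.disj
  refine ⟨x, hx, r, hr, I, hI, ?_⟩
  rcases hor with hor | hor
  · exact ⟨w, .inr hw, hwI, by rintro rfl; exact hAB hx hw, hor.symm⟩
  · obtain ⟨z, hz, hzx⟩ := Finset.exists_mem_ne (by omega : 1 < A.card) x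
    exact ⟨z, .inl hz, fun hzI => hAB hz (hor hzI), hzx, by rintro rfl; exact hAB hz hr⟩

theorem Attached.separatedFrom (h : Attached R A B U J v)
    (hs : SeparatedFrom (contractRel R J v) (A \ J) (B \ J) v) : SeparatedFrom R A B v := by
  have hAB := Finset.disjoint_left.1 h.pair.disj
  obtain ⟨x, hx, r, hr, I, hI, hvI, hor⟩ := hs
  rw [Finset.mem_sdiff] at hx hr
  have hIJ : ∀ i ∈ I, i ∉ J := fun i hi => by
    rcases hI.sub i hi with h' | h' <;> exact (Finset.mem_sdiff.1 h').2
  refine ⟨x, hx.1, r, hr.1, I, ⟨hI.nonempty, ?_, hI.left, hI.right, ?_⟩, hvI,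
    hor.imp_right fun h' => h'.trans Finset.sdiff_subset⟩
  · exact fun i hi => (hI.sub i hi).imp (fun h' => (Finset.mem_sdiff.1 h').1)
      fun h' => (Finset.mem_sdiff.1 h').1
  · intro i hi j hj hij
    by_cases hjJ : j ∈ J
    · exfalso
      rcases hI.adj i hi v (.inr (by simp [h.mem, h.notMem])) (.inr (.inr ⟨rfl, j, hjJ, hij⟩))
        with h' | h' | h'
      · exact hvI h'
      · exact hAB hx.1 (h' ▸ h.mem)
      · have hIB := hor.resolve_left (fun hne => hne h'.symm)
        have hiB := Finset.mem_sdiff.1 (hIB hi)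
        rcases h.adj j hjJ i (.inr hiB.1) (h.pair.symm _ _ hij) with h1 | h1 | h1
        · exact hiB.2 h1
        · exact hAB (h.nice.sub h1) hiB.1
        · exact hvI (h1 ▸ hi)
    · exact hI.adj i hi j (by simpa [hjJ] using hj) (.inl hij)

theorem separated_of_nice (h : TightPair R A B) (hB : 3 ≤ B.card) (hU : Nice R A U)
    (hU3 : 3 ≤ U.card) (hUA : U.card < A.card)
    (ih : ∀ (R' : V → V → Prop) (A' B' : Finset V), TightPair R' A' B' → 3 ≤ A'.card →
      3 ≤ B'.card → A'.card + B'.card < A.card + B.card → ∀ w ∈ B', SeparatedFrom R' A' B' w) :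
    Separated R A B := by
  have hAB := Finset.disjoint_left.1 h.disj
  have hsub := hU.sub
  obtain ⟨u, hu⟩ : U.Nonempty := Finset.card_pos.1 (by omega)
  have hA : 3 ≤ A.card := by omega
  have hc : (insert u (A \ U)).card = A.card - U.card + 1 := by
    rw [Finset.card_insert_of_notMem (by simp [hu]), Finset.card_sdiff_of_subset hsub]
  have hodd := odd_card_of_crit (h.contract_nice hU hu).critA (Finset.insert_nonempty _ _)
  obtain ⟨x, hx, r, hr, I, hI, huI, hor⟩ := ih _ _ _ (h.contract_nice hU hu).swap hB
    (by clear ih h; grind) (by omega) u (by simp)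
  have hxu : x ≠ u := by rintro rfl; exact hAB (hsub hu) hx
  have hIAB : ∀ i ∈ I, i ∈ A ∧ i ∉ U ∨ i ∈ B := by
    intro i hi
    rcases hI.sub i hi with h' | h'
    · exact .inr h'
    · rcases Finset.mem_insert.1 h' with rfl | h'
      · exact absurd hi huI
      · exact .inl (Finset.mem_sdiff.1 h')
  have hadj : ∀ i ∈ I, ∀ j, j ∈ A ∨ j ∈ B → R i j → j ∈ I ∨ j = x ∨ (j = r ∧ j ∉ U) ∨
      (j ∈ U ∧ r = u) := by
    intro i hi j hj hij
    by_cases hjU : j ∈ U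
    · rcases hI.adj i hi u (.inr (by simp)) (.inr (.inr ⟨rfl, j, hjU, hij⟩)) with h' | h' | h'
      · exact absurd h' huI
      · exact absurd h'.symm hxu
      · exact .inr (.inr (.inr ⟨hjU, h'.symm⟩))
    · rcases hI.adj i hi j (hj.symm.imp_right fun hjA => by simp [hjA, hjU]) (.inl hij)
        with h' | h' | h'
      · exact .inl h'
      · exact .inr (.inl h')
      · exact .inr (.inr (.inl ⟨h', hjU⟩))
  by_cases hru : r = u
  · subst hru
    have hIA : ∀ i ∈ I, i ∈ A ∧ i ∉ U := by
      intro i hi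
      refine (hIAB i hi).resolve_right fun hiB => ?_
      have := hor.resolve_left (fun hne => hne rfl) hi
      rcases Finset.mem_insert.1 this with rfl | h'
      · exact huI hi
      · exact hAB (Finset.mem_sdiff.1 h').1 hiB
    have hat : Attached R A B U I x := by
      refine ⟨h, hU, hx, fun i hi => .inl (hIA i hi).1, hI.left, fun i hi => (hIA i hi).2, ?_⟩
      intro i hi j hj hij
      rcases hadj i hi j hj hij with h' | h' | h' | h'
      · exact .inl h'
      · exact .inr (.inr h')
      · exact absurd (h'.1 ▸ hu) h'.2
      · exact .inr (.inl h'.1)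
    have hBI : B \ I = B := by
      rw [Finset.sdiff_eq_self_iff_disjoint, Finset.disjoint_left]
      exact fun b hb hbI => hAB (hIA b hbI).1 hb
    have hUI : U ⊆ A \ I := fun z hz => Finset.mem_sdiff.2 ⟨hsub hz, fun hzI => (hIA z hzI).2 hz⟩
    have hcard : (A \ I).card < A.card := by
      obtain ⟨i, hi⟩ := hI.nonempty
      exact Finset.card_lt_card (Finset.ssubset_iff_of_subset Finset.sdiff_subset |>.2
        ⟨i, (hIA i hi).1, by simp [hi]⟩)
    refine h.separated_of_from hA hx (hat.separatedFrom (ih _ _ _ hat.contract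
      (hU3.trans (Finset.card_le_card hUI)) (by rwa [hBI]) (by rw [hBI]; omega) x ?_))
    rwa [hBI]
  · have hrA : r ∈ A ∧ r ∉ U := by simpa [hru] using hr
    refine ⟨r, hrA.1, x, hx, I, ⟨hI.nonempty, fun i hi => (hIAB i hi).imp_left And.left, hI.right,
      hI.left, ?_⟩, u, .inl (hsub hu), huI, Ne.symm hru, hxu.symm⟩
    intro i hi j hj hij
    rcases hadj i hi j hj hij with h' | h' | h' | h'
    · exact .inl h'
    · exact .inr (.inr h')
    · exact .inr (.inl h'.1)
    · exact absurd h'.2 hru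

theorem separatedFrom_of_side (h : TightPair R A B) (hx : x ∈ A) (hw : w ∈ B)
    (hJ : Side R A B x w J) {a b : V} (ha : a ∈ A) (hax : a ≠ x) (haJ : a ∉ J) (hb : b ∈ B)
    (hbw : b ≠ w) (hbJ : b ∉ J)
    (ih : ∀ (R' : V → V → Prop) (A' B' : Finset V), TightPair R' A' B' → 3 ≤ A'.card →
      3 ≤ B'.card → A'.card + B'.card < A.card + B.card → ∀ w ∈ B', SeparatedFrom R' A' B' w) :
    SeparatedFrom R A B w := by
  have hat : Attached R A B {x} J w := by
    refine ⟨h, .singleton h.symm h.critA hx, hw, hJ.sub, hJ.right, ?_, ?_⟩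
    · intro j hj hjx
      rw [Finset.mem_singleton] at hjx
      exact hJ.left (hjx ▸ hj)
    · simpa using hJ.adj
  have three : ∀ {S : Finset V} (_ : ∀ s ∈ S, Matchable (contractRel R J w) (S \ {s})) {p q : V},
      p ∈ S → q ∈ S → p ≠ q → 3 ≤ S.card := by
    intro S hS p q hp hq hpq
    have h1 := odd_card_of_crit hS ⟨p, hp⟩
    have h2 := Finset.one_lt_card.2 ⟨p, hp, q, hq, hpq⟩
    clear ih h hS hat
    grind
  have hc := hat.contract
  refine hat.separatedFrom (ih _ _ _ hc
    (three hc.critA (p := a) (q := x) (by simp [ha, haJ]) (by simp [hx, hJ.left]) hax)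
    (three hc.critB (p := b) (q := w) (by simp [hb, hbJ]) (by simp [hw, hJ.right]) hbw) ?_ w
    (by simp [hw, hJ.right]))
  have h1 := Finset.card_le_card (Finset.sdiff_subset (s := A) (t := J))
  have h2 := Finset.card_le_card (Finset.sdiff_subset (s := B) (t := J))
  obtain ⟨j, hj⟩ := hJ.nonempty
  rcases hJ.sub j hj with hjA | hjB
  · have : (A \ J).card < A.card := Finset.card_lt_card
      (Finset.ssubset_iff_of_subset Finset.sdiff_subset |>.2 ⟨j, hjA, by simp [hj]⟩)
    omega
  · have : (B \ J).card < B.card := Finset.card_lt_card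
      (Finset.ssubset_iff_of_subset Finset.sdiff_subset |>.2 ⟨j, hjB, by simp [hj]⟩)
    omega

theorem exists_oddCycle_of_no_nice (hR : ∀ a b, R a b → R b a)
    (hA : ∀ a ∈ A, Matchable R (A \ {a})) (h3 : 3 ≤ A.card)
    (hno : ∀ U, Nice R A U → 3 ≤ U.card → A.card ≤ U.card) : ∃ n f, OddCycle R A n f := by
  obtain ⟨O, hOA, hm, n, f, hO3, hf⟩ := exists_oddCycle hR hA h3
  have hnice : Nice R A O := .of_rest hR hA hOA (fun u hu => by
    obtain ⟨s, rfl⟩ := (hf.mem u).1 hu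
    exact hf.matchable_sdiff_one s) hm
  obtain rfl := Finset.eq_of_subset_of_card_le hOA (hno O hnice hO3)
  exact ⟨n, f, hf⟩

theorem separated (h : TightPair R A B) (hA : 3 ≤ A.card) (hB : 3 ≤ B.card)
    (ih : ∀ (R' : V → V → Prop) (A' B' : Finset V), TightPair R' A' B' → 3 ≤ A'.card →
      3 ≤ B'.card → A'.card + B'.card < A.card + B.card → ∀ w ∈ B', SeparatedFrom R' A' B' w) :
    Separated R A B := by
  by_cases h1 : ∀ U, Nice R A U → 3 ≤ U.card → A.card ≤ U.card
  · by_cases h2 : ∀ U, Nice R B U → 3 ≤ U.card → B.card ≤ U.card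
    · obtain ⟨n, f, hf⟩ := exists_oddCycle_of_no_nice h.symm h.critA hA h1
      obtain ⟨m, g, hg⟩ := exists_oddCycle_of_no_nice h.symm h.critB hB h2
      obtain ⟨x, hx, y, hy, hxy⟩ := h.exists_cover hf hg
      have hAB := Finset.disjoint_left.1 h.disj
      obtain ⟨z, hz, hzy⟩ := Finset.exists_mem_ne (by omega : 1 < B.card) y
      obtain ⟨i, hi, hix⟩ := Finset.exists_mem_ne (by omega : 1 < A.card) x
      refine ⟨x, hx, y, hy, A \ {x}, ⟨⟨i, by simp [hi, hix]⟩, ?_, by simp, ?_, ?_⟩, z, .inr hz,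
        ?_, ?_, hzy⟩
      · exact fun i hi => .inl (Finset.mem_sdiff.1 hi).1
      · exact fun hy' => hAB (Finset.mem_sdiff.1 hy').1 hy
      · intro i hi j hj hij
        rw [Finset.mem_sdiff, Finset.mem_singleton] at hi
        rcases hj with hj | hj
        · by_cases hjx : j = x
          · exact .inr (.inl hjx)
          · exact .inl (by simp [hj, hjx])
        · exact .inr (.inr ((hxy i hi.1 j hj hij).resolve_left hi.2))
      · exact fun hz' => hAB (Finset.mem_sdiff.1 hz').1 hz
      · rintro rfl
        exact hAB hx hz
    · push Not at h2
      obtain ⟨U, hU, hU3, hUB⟩ := h2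
      refine (h.swap.separated_of_nice hA hU hU3 hUB ?_).swap
      rwa [add_comm]
  · push Not at h1
    obtain ⟨U, hU, hU3, hUA⟩ := h1
    exact h.separated_of_nice hB hU hU3 hUA ih

theorem separatedFrom (N : ℕ) : ∀ (R : V → V → Prop) (A B : Finset V), TightPair R A B →
    3 ≤ A.card → 3 ≤ B.card → A.card + B.card = N → ∀ w ∈ B, SeparatedFrom R A B w := by
  induction N using Nat.strong_induction_on with
  | _ N ih =>
    intro R A B h hA hB hN w hw
    have hAB := Finset.disjoint_left.1 h.disj
    have ih' : ∀ (R' : V → V → Prop) (A' B' : Finset V), TightPair R' A' B' → 3 ≤ A'.card →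
        3 ≤ B'.card → A'.card + B'.card < A.card + B.card →
        ∀ w ∈ B', SeparatedFrom R' A' B' w :=
      fun R' A' B' h' hA' hB' hlt => ih _ (hN ▸ hlt) R' A' B' h' hA' hB' rfl
    obtain ⟨x, hx, r, hr, I, hI, z, hz, hzI, hzx, hzr⟩ := h.separated hA hB ih'
    have hJ : Side R A B x r (((A ∪ B) \ I) \ {x, r}) := by
      refine ⟨⟨z, by simp [hz, hzI, hzx, hzr]⟩, ?_, by simp, by simp, ?_⟩
      · intro i hi
        simp only [Finset.mem_sdiff, Finset.mem_union] at hi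
        exact hi.1.1
      · intro i hi j hj hij
        by_contra hc
        simp only [Finset.mem_sdiff, Finset.mem_union, Finset.mem_insert, Finset.mem_singleton,
          not_or] at hi hc
        have hjI : j ∈ I := by
          by_contra hjI
          exact hc.1 ⟨⟨hj, hjI⟩, hc.2⟩
        rcases hI.adj j hjI i hi.1.1 (h.symm _ _ hij) with h' | h' | h'
        · exact hi.1.2 h'
        · exact hi.2.1 h'
        · exact hi.2.2 h'
    have hcover : ∀ i, i ∈ A ∨ i ∈ B → i ≠ x → i ≠ r → i ∈ I ∨ i ∈ ((A ∪ B) \ I) \ {x, r} := by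
      intro i hi hix hir
      by_cases hiI : i ∈ I
      · exact .inl hiI
      · exact .inr (by simp [hi, hiI, hix, hir])
    have hdis : ∀ i ∈ I, i ∉ ((A ∪ B) \ I) \ {x, r} := by
      intro i hi hi'
      simp [hi] at hi'
    generalize ((A ∪ B) \ I) \ {x, r} = J at hJ hcover hdis
    by_cases hrw : r = w
    · subst hrw
      by_cases hIB : I ⊆ B
      · exact ⟨x, hx, r, hr, I, hI, hI.right, .inr hIB⟩
      by_cases hJB : J ⊆ B
      · exact ⟨x, hx, r, hr, J, hJ, hJ.right, .inr hJB⟩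
      obtain ⟨a, haI, haB⟩ := Finset.not_subset.1 hIB
      obtain ⟨a', haJ, haB'⟩ := Finset.not_subset.1 hJB
      have haA := (hI.sub a haI).resolve_right haB
      have haA' := (hJ.sub a' haJ).resolve_right haB'
      obtain ⟨b, hb, hbr⟩ := Finset.exists_mem_ne (by omega : 1 < B.card) r
      rcases hcover b (.inr hb) (by rintro rfl; exact hAB hx hb) hbr with hbI | hbJ
      · exact h.separatedFrom_of_side hx hw hJ haA (ne_of_mem_of_not_mem haI hI.left)
          (hdis a haI) hb hbr (hdis b hbI) ih'
      · exact h.separatedFrom_of_side hx hw hI haA' (ne_of_mem_of_not_mem haJ hJ.left)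
          (fun h' => hdis a' h' haJ) hb hbr (fun h' => hdis b h' hbJ) ih'
    · by_cases hwI : w ∈ I
      · exact ⟨x, hx, r, hr, J, hJ, hdis w hwI, .inl hrw⟩
      · exact ⟨x, hx, r, hr, I, hI, hwI, .inl hrw⟩

end TightPair

end Separation

section Partition

variable {V : Type*} [DecidableEq V] [Fintype V] {H : V → V → Prop}

theorem exists_partition [Nonempty V] (hH : ∀ a b, H a b → H b a)
    (hno : ¬ Matchable H (Finset.univ : Finset V))
    (hex : ∀ v, ∃ v', v' ≠ v ∧ Matchable H (Finset.univ \ {v, v'})) :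
    ∃ A B : Finset V, Disjoint A B ∧ A ∪ B = Finset.univ ∧ A.Nonempty ∧ B.Nonempty ∧
      (∀ a ∈ A, Matchable H (A \ {a})) ∧ (∀ b ∈ B, Matchable H (B \ {b})) ∧
      (∀ a ∈ A, ∀ b ∈ B, ¬ H a b) ∧
      ∀ a b, a ≠ b → Matchable H (Finset.univ \ {a, b}) → a ∈ A ∧ b ∈ B ∨ a ∈ B ∧ b ∈ A := by
  classical
  let E : V → V → Prop := fun u v => u = v ∨ ¬ Matchable H (Finset.univ \ {u, v})
  have Erefl : ∀ u, E u u := fun u => .inl rfl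
  have Esymm : ∀ u v, E u v → E v u := by
    rintro u v (h | h)
    · exact .inl h.symm
    · exact .inr (by rwa [Finset.pair_comm])
  have Etrans : ∀ u v w, E u v → E v w → E u w := by
    rintro u v w (rfl | huv) hvw
    · exact hvw
    rcases hvw with rfl | hvw
    · exact .inr huv
    by_contra hc
    obtain ⟨huw, hm⟩ : u ≠ w ∧ Matchable H (Finset.univ \ {u, w}) := by
      simpa [E] using hc
    have hvu : v ≠ u := by rintro rfl; exact hvw hm
    have hvw' : v ≠ w := by rintro rfl; exact huv hm
    obtain ⟨v', hv', hm'⟩ := hex v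
    rcases Matchable.exchange_pairs hH _ Finset.univ rfl (Finset.mem_univ u) (Finset.mem_univ w)
      (Finset.mem_univ v') huw (by rintro rfl; rw [Finset.pair_comm] at hm'; exact huv hm')
      (by rintro rfl; exact hvw hm') v (Finset.mem_univ v) hvu hvw' hv'.symm hm hm' with h | h | h
    · exact hno h
    · exact hvw h
    · rw [Finset.pair_comm] at h
      exact huv h
  have EH : ∀ a b, H a b → E a b := by
    intro a b hab
    by_contra hc
    obtain ⟨hne, hm⟩ : a ≠ b ∧ Matchable H (Finset.univ \ {a, b}) := by
      simpa [E] using hc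
    exact hno (.add_pair (Finset.mem_univ a) (Finset.mem_univ b) hne hab hm)
  have part : ∀ x y, ¬ E x y → Matchable H (Finset.univ \ {x, y}) := by
    intro x y hc
    obtain ⟨-, hm⟩ : x ≠ y ∧ Matchable H (Finset.univ \ {x, y}) := by
      simpa [E] using hc
    exact hm
  let K : V → Finset V := fun v => Finset.univ.filter (E v)
  have memK : ∀ v u, u ∈ K v ↔ E v u := fun v u => by simp [K]
  have restrict : ∀ v x y, ¬ E x y → Matchable H (K v \ {x, y}) := by
    intro v x y hxy
    refine (part x y hxy).of_closed hH _ (Finset.sdiff_subset_sdiff (Finset.subset_univ _) le_rfl)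
      ?_
    intro a ha b hb hab
    simp only [Finset.mem_sdiff, memK] at ha hb
    exact hb.2 ⟨Etrans _ _ _ ha.1 (EH _ _ hab), hb.1.2⟩
  have crit : ∀ v x y, E v x → ¬ E v y → Matchable H (K v \ {x}) := by
    intro v x y hx hy
    convert restrict v x y (fun h => hy (Etrans _ _ _ hx h)) using 1
    ext z
    simp only [Finset.mem_sdiff, memK, Finset.mem_singleton, Finset.mem_insert, not_or]
    constructor
    · rintro ⟨h1, h2⟩
      exact ⟨h1, h2, by rintro rfl; exact hy h1⟩
    · rintro ⟨h1, h2, -⟩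
      exact ⟨h1, h2⟩
  obtain ⟨p⟩ := ‹Nonempty V›
  obtain ⟨q, hqp, hm⟩ := hex p
  have hpq : ¬ E p q := by
    rintro (h | h)
    · exact hqp h.symm
    · exact h hm
  have hqp' : ¬ E q p := fun h => hpq (Esymm _ _ h)
  have cover : ∀ w, E p w ∨ E q w := by
    intro w
    by_contra! hc
    have h1 := (crit p p q (Erefl p) hpq).even_card
    have h2 := restrict p q w hc.2
    rw [Finset.sdiff_eq_self_iff_disjoint.2 (by
      rw [Finset.disjoint_left]
      intro z hz hz'
      rw [memK] at hz
      simp only [Finset.mem_insert, Finset.mem_singleton] at hz'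
      rcases hz' with rfl | rfl
      exacts [hpq hz, hc.1 hz])] at h2
    have h2 := h2.even_card
    have hp : p ∈ K p := (memK p p).2 (Erefl p)
    rw [Finset.card_sdiff_of_subset (by simpa using hp), Finset.card_singleton] at h1
    have hpos : 0 < (K p).card := Finset.card_pos.2 ⟨p, hp⟩
    obtain ⟨s, hs⟩ := h1
    obtain ⟨t, ht⟩ := h2
    omega
  refine ⟨K p, K q, ?_, ?_, ⟨p, (memK p p).2 (Erefl p)⟩, ⟨q, (memK q q).2 (Erefl q)⟩,
    fun a ha => crit p a q ((memK p a).1 ha) hpq, fun a ha => crit q a p ((memK q a).1 ha) hqp',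
    ?_, ?_⟩
  · rw [Finset.disjoint_left]
    intro z hz hz'
    rw [memK] at hz hz'
    exact hpq (Etrans _ _ _ hz (Esymm _ _ hz'))
  · ext z
    simpa [memK] using cover z
  · intro a ha b hb hab
    rw [memK] at ha hb
    exact hpq (Etrans _ _ _ (Etrans _ _ _ ha (EH _ _ hab)) (Esymm _ _ hb))
  · intro a b hab hm
    have hE : ¬ E a b := by
      rintro (h | h)
      · exact hab h
      · exact h hm
    simp only [memK]
    rcases cover a with h1 | h1 <;> rcases cover b with h2 | h2
    · exact absurd (Etrans _ _ _ (Esymm _ _ h1) h2) hE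
    · exact .inl ⟨h1, h2⟩
    · exact .inr ⟨h1, h2⟩
    · exact absurd (Etrans _ _ _ (Esymm _ _ h1) h2) hE

end Partition

namespace Multigraph

section

variable {V E : Type} {G : Multigraph V E}

/-- `a` and `b` are the two endpoints of `e`. -/
def Joins (G : Multigraph V E) (e : E) (a b : V) : Prop :=
  G.fst e = a ∧ G.snd e = b ∨ G.fst e = b ∧ G.snd e = a

theorem Joins.symm {e : E} {a b : V} (h : G.Joins e a b) : G.Joins e b a := Or.symm h

theorem Joins.inc_iff {e : E} {a b v : V} (h : G.Joins e a b) : G.Inc e v ↔ v = a ∨ v = b := by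
  rcases h with ⟨rfl, rfl⟩ | ⟨rfl, rfl⟩ <;> simp only [Inc, eq_comm]
  rw [or_comm]

theorem Joins.ne {e : E} {a b : V} (h : G.Joins e a b) : a ≠ b := by
  rcases h with ⟨rfl, rfl⟩ | ⟨rfl, rfl⟩
  · exact G.no_loop e
  · exact (G.no_loop e).symm

theorem Inc.exists_joins {e : E} {v : V} (h : G.Inc e v) : ∃ u, G.Joins e v u := by
  rcases h with h | h
  · exact ⟨_, .inl ⟨h, rfl⟩⟩
  · exact ⟨_, .inr ⟨rfl, h⟩⟩

/-- `a` and `b` are joined by an edge satisfying `P`. -/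
def JoinedBy (G : Multigraph V E) (P : E → Prop) (a b : V) : Prop := ∃ e, P e ∧ G.Joins e a b

theorem IsPerfectMatchingOn.joins_mem {S : Set V} {M : Set E} (h : G.IsPerfectMatchingOn S M)
    {e : E} {a b : V} (he : e ∈ M) (hab : G.Joins e a b) : a ∈ S ∧ b ∈ S := by
  have := h.1 e he
  rcases hab with ⟨rfl, rfl⟩ | ⟨rfl, rfl⟩
  exacts [this, this.symm]

theorem IsPerfectMatchingOn.erase {S : Set V} {M : Set E} (h : G.IsPerfectMatchingOn S M) {e : E}
    {a b : V} (he : e ∈ M) (hab : G.Joins e a b) :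
    G.IsPerfectMatchingOn (S \ {a, b}) (M \ {e}) := by
  have hS := h.joins_mem he hab
  have away : ∀ e' ∈ M \ {e}, ∀ v, G.Inc e' v → v ∉ ({a, b} : Set V) := by
    rintro e' ⟨he', hne⟩ v hv hvab
    have hvS : v ∈ S := by
      rcases hvab with rfl | rfl
      exacts [hS.1, hS.2]
    exact hne ((h.2 v hvS).unique ⟨he', hv⟩ ⟨he, hab.inc_iff.2 hvab⟩)
  refine ⟨fun e' he' => ⟨⟨(h.1 e' he'.1).1, away e' he' _ (.inl rfl)⟩,
    ⟨(h.1 e' he'.1).2, away e' he' _ (.inr rfl)⟩⟩, fun v hv => ?_⟩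
  obtain ⟨e', ⟨he', hv'⟩, huniq⟩ := h.2 v hv.1
  refine ⟨e', ⟨⟨he', ?_⟩, hv'⟩, fun f hf => huniq f ⟨hf.1.1, hf.2⟩⟩
  rintro rfl
  exact hv.2 (hab.inc_iff.1 hv')

theorem IsPerfectMatchingOn.insert {S : Set V} {M : Set E} (h : G.IsPerfectMatchingOn S M) {e : E}
    {a b : V} (hab : G.Joins e a b) (ha : a ∉ S) (hb : b ∉ S) :
    G.IsPerfectMatchingOn (insert a (insert b S)) (insert e M) := by
  have hnot : ∀ e' ∈ M, ∀ v, G.Inc e' v → v ∈ S := by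
    rintro e' he' v (rfl | rfl)
    exacts [(h.1 e' he').1, (h.1 e' he').2]
  have hends : ∀ v, G.Inc e v → v ∉ S := by
    intro v hv
    rcases hab.inc_iff.1 hv with rfl | rfl
    exacts [ha, hb]
  constructor
  · rintro e' (rfl | he')
    · rcases hab with ⟨rfl, rfl⟩ | ⟨rfl, rfl⟩ <;> simp
    · simp [h.1 e' he']
  · intro v hv
    by_cases hvS : v ∈ S
    · obtain ⟨e', ⟨he', hv'⟩, huniq⟩ := h.2 v hvS
      refine ⟨e', ⟨.inr he', hv'⟩, ?_⟩
      rintro f ⟨rfl | hf, hfv⟩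
      · exact absurd hvS (hends v hfv)
      · exact huniq f ⟨hf, hfv⟩
    · have hvab : v = a ∨ v = b := by
        rcases hv with hv | hv | hv
        exacts [.inl hv, .inr hv, absurd hv hvS]
      refine ⟨e, ⟨.inl rfl, hab.inc_iff.2 hvab⟩, ?_⟩
      rintro f ⟨rfl | hf, hfv⟩
      · rfl
      · exact absurd (hnot f hf v hfv) hvS

theorem IsPerfectMatchingOn.matchable [DecidableEq V] {P : E → Prop} (n : ℕ) :
    ∀ (S : Finset V) (M : Set E), S.card = n → G.IsPerfectMatchingOn (S : Set V) M →
      (∀ e ∈ M, P e) → Matchable (G.JoinedBy P) S := by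
  induction n using Nat.strong_induction_on with
  | _ n ih =>
    intro S M hn hM hP
    rcases S.eq_empty_or_nonempty with rfl | ⟨v, hv⟩
    · exact .empty
    obtain ⟨e, ⟨he, hev⟩, -⟩ := hM.2 v hv
    obtain ⟨u, hvu⟩ := hev.exists_joins
    have hu : u ∈ S := (hM.joins_mem he hvu).2
    have hlt : (S \ {v, u}).card < n := by
      rw [← hn]
      exact Finset.card_lt_card (Finset.ssubset_iff_of_subset Finset.sdiff_subset |>.2
        ⟨v, hv, by simp⟩)
    refine .add_pair hv hu hvu.ne ⟨e, hP e he, hvu⟩ (ih _ hlt _ (M \ {e}) rfl ?_ fun f hf => hP f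
      hf.1)
    simpa using hM.erase he hvu

theorem exists_isPerfectMatchingOn [DecidableEq V] {P : E → Prop} {S : Finset V}
    (h : Matchable (G.JoinedBy P) S) :
    ∃ M : Set E, G.IsPerfectMatchingOn (S : Set V) M ∧ ∀ e ∈ M, P e := by
  induction h with
  | empty => exact ⟨∅, ⟨by simp, by simp⟩, by simp⟩
  | @pair a b S ha hb hab h hS ih =>
    obtain ⟨M, hM, hP⟩ := ih
    obtain ⟨e, he, hj⟩ := h
    refine ⟨insert e M, ?_, ?_⟩
    · simpa using hM.insert hj (by simpa using ha) (by simpa using hb)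
    · rintro f (rfl | hf)
      exacts [he, hP f hf]

variable {c : E → V → Bool}

theorem IsWState.exists_bichromatic (h : G.IsWState c) (v : V) :
    ∃ e, G.Bichromatic c e ∧ G.Inc e v := by
  obtain ⟨e, he, hred⟩ := h.2.2.1 v
  refine ⟨e, by_contra fun hb => ?_, he⟩
  have h1 := h.2.2.2 e hb
  have h2 : c e (G.fst e) = c e (G.snd e) := not_not.1 hb
  rcases he with rfl | rfl
  · rw [h1] at hred; cases hred
  · rw [← h2, h1] at hred; cases hred

theorem IsWState.matchable_of_bichromatic [Fintype V] [DecidableEq V] (h : G.IsWState c) {e : E}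
    {a b : V} (he : G.Bichromatic c e) (hab : G.Joins e a b) :
    Matchable (G.JoinedBy fun e => ¬ G.Bichromatic c e) (Finset.univ \ {a, b}) := by
  obtain ⟨M, hM, heM⟩ := h.1 e
  refine IsPerfectMatchingOn.matchable _ _ (M \ {e}) rfl ?_ ?_
  · simpa using IsPerfectMatchingOn.erase hM heM hab
  · exact fun f hf hb => hf.2 ((h.2.1 M hM).unique ⟨hf.1, hb⟩ ⟨heM, he⟩)

theorem IsWState.not_matchable [Fintype V] [DecidableEq V] (h : G.IsWState c) :
    ¬ Matchable (G.JoinedBy fun e => ¬ G.Bichromatic c e) (Finset.univ : Finset V) := by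
  intro hm
  obtain ⟨M, hM, hP⟩ := exists_isPerfectMatchingOn hm
  obtain ⟨e, he, -⟩ := h.2.1 M (by simpa [IsPerfectMatching] using hM)
  exact hP e he.1 he.2

theorem joinedBy_symm {P : E → Prop} (a b : V) (h : G.JoinedBy P a b) : G.JoinedBy P b a := by
  obtain ⟨e, he, hab⟩ := h
  exact ⟨e, he, hab.symm⟩

/-- The bichromatic edges of a W-state graph form a cut with factor-critical shores. -/
theorem IsWState.exists_tightPair [Fintype V] [DecidableEq V] (h : G.IsWState c) :
    ∃ A B : Finset V, TightPair (G.JoinedBy fun _ => True) A B ∧ A ∪ B = Finset.univ ∧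
      A.Nonempty ∧ B.Nonempty ∧
      ∀ e a b, G.Joins e a b → (G.Bichromatic c e ↔ a ∈ A ∧ b ∈ B ∨ a ∈ B ∧ b ∈ A) := by
  have hne : Nonempty V := by
    by_contra hV
    rw [not_nonempty_iff] at hV
    exact h.not_matchable (by rw [Finset.univ_eq_empty]; exact .empty)
  obtain ⟨A, B, hAB, hU, hA, hB, cA, cB, hno, hsplit⟩ := exists_partition joinedBy_symm
    h.not_matchable (fun v => by
      obtain ⟨e, he, hv⟩ := h.exists_bichromatic v
      obtain ⟨u, hvu⟩ := hv.exists_joins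
      exact ⟨u, hvu.ne.symm, h.matchable_of_bichromatic he hvu⟩)
  have hAB' := Finset.disjoint_left.1 hAB
  have bic : ∀ e a b, G.Joins e a b →
      (G.Bichromatic c e ↔ a ∈ A ∧ b ∈ B ∨ a ∈ B ∧ b ∈ A) := by
    intro e a b hab
    refine ⟨fun he => hsplit a b hab.ne (h.matchable_of_bichromatic he hab), fun hs => ?_⟩
    by_contra he
    rcases hs with hs | hs
    · exact hno a hs.1 b hs.2 ⟨e, he, hab⟩
    · exact hno b hs.2 a hs.1 ⟨e, he, hab.symm⟩
  have cut : ∀ v, ∃ u, (v ∈ A ∧ u ∈ B ∨ v ∈ B ∧ u ∈ A) ∧ G.JoinedBy (fun _ => True) v u := by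
    intro v
    obtain ⟨e, he, hv⟩ := h.exists_bichromatic v
    obtain ⟨u, hvu⟩ := hv.exists_joins
    exact ⟨u, (bic e v u hvu).1 he, e, trivial, hvu⟩
  have hmono : ∀ {S : Finset V}, Matchable (G.JoinedBy fun e => ¬ G.Bichromatic c e) S →
      Matchable (G.JoinedBy fun _ => True) S := fun hS =>
    hS.mono fun _ _ _ _ ⟨e, _, he⟩ => ⟨e, trivial, he⟩
  refine ⟨A, B, ⟨joinedBy_symm, hAB, fun a ha => hmono (cA a ha), fun b hb => hmono (cB b hb),
    ?_, ?_, ?_⟩, hU, hA, hB, bic⟩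
  · intro a ha
    obtain ⟨u, hs | hs, hau⟩ := cut a
    · exact ⟨u, hs.2, hau⟩
    · exact absurd hs.1 (hAB' ha)
  · intro b hb
    obtain ⟨u, hs | hs, hbu⟩ := cut b
    · exact absurd hb (hAB' hs.1)
    · exact ⟨u, hs.2, hbu⟩
  · rintro a ha a' ha' b hb b' hb' haa hbb ⟨e, -, hab⟩ ⟨e', -, hab'⟩ hm
    obtain ⟨M, hM, -⟩ := exists_isPerfectMatchingOn hm
    have nab : ∀ {x y : V}, x ∈ A → y ∈ B → x ≠ y := by
      rintro x y hx hy rfl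
      exact hAB' hx hy
    have hM1 := hM.insert hab' (by simp) (by simp)
    have hM2 := hM1.insert hab (by simp [haa, nab ha hb']) (by
      simp [hbb, (nab ha' hb).symm])
    have hM3 : G.IsPerfectMatching (Insert.insert e (Insert.insert e' M)) := by
      unfold IsPerfectMatching
      convert hM2 using 1
      ext z
      have := Finset.ext_iff.1 hU z
      simp only [Finset.mem_union, Finset.mem_univ, iff_true] at this
      simp [this]
      tauto
    have := (h.2.1 _ hM3).unique ⟨by simp, (bic e a b hab).2 (.inl ⟨ha, hb⟩)⟩
      ⟨show e' ∈ _ by simp, (bic e' a' b' hab').2 (.inl ⟨ha', hb'⟩)⟩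
    subst this
    rcases hab'.inc_iff.1 (hab.inc_iff.2 (.inl rfl)) with h' | h'
    · exact haa h'
    · exact nab ha hb' h'

theorem IsWState.isWConeWithApex (h : G.IsWState c) {v : V} {A B : Finset V}
    (hA : A = {v}) (hAB : ∀ x, x ∈ A ∨ x ∈ B) (hdis : ∀ x ∈ A, x ∉ B)
    (hbic : ∀ e a b, G.Joins e a b → (G.Bichromatic c e ↔ a ∈ A ∧ b ∈ B ∨ a ∈ B ∧ b ∈ A)) :
    G.IsWConeWithApex c v := by
  subst hA
  have hB : ∀ x, x ≠ v → x ∈ B := fun x hx => (hAB x).resolve_left (by simpa using hx)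
  refine ⟨h.1, ?_, ?_, h.2.2.1, h.2.2.2⟩
  · intro u huv
    obtain ⟨e, he, hu⟩ := h.exists_bichromatic u
    obtain ⟨w, huw⟩ := hu.exists_joins
    refine ⟨huv, e, trivial, hu, ?_⟩
    rcases (hbic e u w huw).1 he with h' | h'
    · exact absurd (by simpa using h'.1) huv
    · rw [huw.inc_iff]
      exact .inr (by simpa [eq_comm] using h'.2)
  · intro e
    constructor
    · intro he
      have hj : G.Joins e (G.fst e) (G.snd e) := .inl ⟨rfl, rfl⟩
      rcases (hbic e _ _ hj).1 he with h' | h'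
      · exact .inl (by simpa using h'.1)
      · exact .inr (by simpa using h'.2)
    · intro hv
      obtain ⟨u, hvu⟩ := hv.exists_joins
      exact (hbic e v u hvu).2 (.inl ⟨by simp, hB u hvu.ne.symm⟩)

theorem not_connectedOn_of_separated [DecidableEq V] {A B : Finset V}
    (hs : Separated (G.JoinedBy fun _ => True) A B) (hAB : ∀ x, x ∈ A ∨ x ∈ B) :
    ∃ S : Set V, S.ncard ≤ 2 ∧ ¬ G.ConnectedOn Set.univ (Set.univ \ S) := by
  obtain ⟨x, hx, r, hr, I, hI, z, hz, hzI, hzx, hzr⟩ := hs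
  refine ⟨{x, r}, (Set.ncard_insert_le x {r}).trans (by simp), fun hcon => ?_⟩
  obtain ⟨i, hi⟩ := hI.nonempty
  have hreach := hcon i ⟨trivial, by
    rintro (rfl | rfl)
    exacts [hI.left hi, hI.right hi]⟩ z ⟨trivial, by simp [hzx, hzr]⟩
  refine hzI ?_
  unfold ReachOn at hreach
  clear hz hzI hzx hzr
  induction hreach with
  | refl => exact hi
  | @tail b d _ hstep ih =>
    obtain ⟨-, hd, hne, e, -, hb, hd'⟩ := hstep
    have hbd : G.Joins e b d := by
      obtain ⟨u, hu⟩ := hb.exists_joins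
      rcases hu.inc_iff.1 hd' with rfl | rfl
      · exact absurd rfl hne
      · exact hu
    rcases hI.adj b ih d (hAB d) ⟨e, trivial, hbd⟩ with h' | h' | h'
    · exact h'
    · exact absurd (.inl h') hd.2
    · exact absurd (.inr h') hd.2

end

end Multigraph

/-- Every 3-connected W-state graph is a W-cone. -/
theorem stmt14 {V E : Type} [Fintype V] [Fintype E] (G : Multigraph V E)
    (c : E → V → Bool) (h : G.IsWState c)
    (h3 : ∀ S : Set V, S.ncard ≤ 2 → G.ConnectedOn Set.univ (Set.univ \ S)) :
    G.IsWCone c := by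
  classical
  obtain ⟨A, B, hp, hU, hA, hB, hbic⟩ := h.exists_tightPair
  have hAB : ∀ x, x ∈ A ∨ x ∈ B := fun x => by
    rw [← Finset.mem_union, hU]
    exact Finset.mem_univ x
  have hdis := Finset.disjoint_left.1 hp.disj
  by_cases hA3 : 3 ≤ A.card
  · by_cases hB3 : 3 ≤ B.card
    · obtain ⟨w, hw⟩ := hB
      have hs := hp.separated_of_from hA3 hw
        (TightPair.separatedFrom _ _ _ _ hp hA3 hB3 rfl w hw)
      obtain ⟨S, hS, hcon⟩ := Multigraph.not_connectedOn_of_separated hs hAB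
      exact absurd (h3 S hS) hcon
    · obtain ⟨k, hk⟩ := TightPair.odd_card_of_crit hp.critB hB
      obtain ⟨v, hv⟩ := Finset.card_eq_one.1 (by omega : B.card = 1)
      exact ⟨v, h.isWConeWithApex hv (fun x => (hAB x).symm) (fun x hx hx' => hdis hx' hx)
        fun e a b hab => (hbic e a b hab).trans or_comm⟩
  · obtain ⟨k, hk⟩ := TightPair.odd_card_of_crit hp.critA hA
    obtain ⟨v, hv⟩ := Finset.card_eq_one.1 (by omega : A.card = 1)
    exact ⟨v, h.isWConeWithApex hv hAB (fun x hx => hdis hx) hbic⟩
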